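/- arXiv:math/0610510 — 5 statements merged into one kernel-verified Lean document; each statement's English description precedes it below -/
import Mathlib

section
/- Let R be a commutative ring, m ≥ 1, n = 2m, and let G be a symmetric n × n matrix over R (G i j = G j i). For subsets I, J of {1,…,n} of size m, write G[I|J] for the determinant of the m × m submatrix of G on rows I and columns J, each taken in increasing order. Then the alternating sum ∑_{i=0}^{m} (−1)^i · G[{1,…,m−1, m+i} | {m, m+1, …, n} \ {m+i}] equals 0. (Kronecker's relation: the complementary m × m minors of a symmetric matrix satisfy the Plücker relations.) -/
open Finset

/-- Deleting the entries `i` and `i.succAbove l` of a tuple in either order gives terms of opposite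
sign, so the alternating sum of symmetric coefficients against the doubly deleted tuples
vanishes. -/
theorem sum_neg_one_pow_mul_symm_mul_removeTwo {R : Type*} [CommRing R] {p : ℕ}
    (S : Fin (p + 2) → Fin (p + 2) → R) (hS : ∀ i j, S i j = S j i)
    (F : (Fin p → Fin (p + 2)) → R) :
    ∑ x : Fin (p + 2) × Fin (p + 1), (-1 : R) ^ (x.1 + x.2 : ℕ) *
      (S x.1 (x.1.succAbove x.2) * F (x.1.succAbove ∘ x.2.succAbove)) = 0 := by
  refine Finset.sum_ninvolution (fun x => (x.1.succAbove x.2, x.2.predAbove x.1)) ?_ ?_ ?_ ?_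
  · rintro ⟨i, l⟩
    have hF : (i.succAbove l).succAbove ∘ (l.predAbove i).succAbove
        = i.succAbove ∘ l.succAbove :=
      funext fun k => Fin.succAbove_succAbove_succAbove_predAbove i l k
    simp only [hF, Fin.neg_one_pow_succAbove_add_predAbove, Fin.succAbove_succAbove_predAbove]
    rw [hS (i.succAbove l) i]
    ring
  · rintro ⟨i, l⟩ _ h
    exact Fin.succAbove_ne i l (congrArg Prod.fst h)
  · simp
  · rintro ⟨i, l⟩
    simp only [Fin.succAbove_succAbove_predAbove, Fin.predAbove_predAbove_succAbove]

/-- Kronecker's relation for a matrix `B` of fixed rows and a symmetric matrix `S`: the determinants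
obtained by appending to `B` the `i`-th row of `S` and deleting the `i`-th column have vanishing
alternating sum. -/
theorem sum_neg_one_pow_mul_det_append_row_eq_zero {R : Type*} [CommRing R] {p : ℕ}
    (B : Matrix (Fin p) (Fin (p + 2)) R) (S : Matrix (Fin (p + 2)) (Fin (p + 2)) R)
    (hS : ∀ i j, S i j = S j i) :
    ∑ i : Fin (p + 2), (-1 : R) ^ (i : ℕ) *
      Matrix.det (Matrix.of fun k l : Fin (p + 1) =>
        if h : (k : ℕ) < p then B ⟨k, h⟩ (i.succAbove l) else S i (i.succAbove l)) = 0 := by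
  have key := sum_neg_one_pow_mul_symm_mul_removeTwo S hS
    fun c => (-1 : R) ^ p * Matrix.det (B.submatrix id c)
  rw [Fintype.sum_prod_type] at key
  rw [← key]
  refine Fintype.sum_congr _ _ fun i => ?_
  rw [Matrix.det_succ_row _ (Fin.last p), Finset.mul_sum]
  refine Fintype.sum_congr _ _ fun l => ?_
  have hsub : (Matrix.of fun k l : Fin (p + 1) =>
        if h : (k : ℕ) < p then B ⟨k, h⟩ (i.succAbove l) else S i (i.succAbove l)).submatrix
        (Fin.last p).succAbove l.succAbove
      = B.submatrix id (i.succAbove ∘ l.succAbove) := by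
    ext a b
    simp
  rw [hsub]
  simp only [Matrix.of_apply, Fin.val_last, lt_irrefl, dite_false, pow_add]
  ring

/-- Kronecker's relation: for a symmetric matrix `G` of even order `n = 2m`, the
alternating sum of the complementary `m × m` minors
`∑_{i=0}^{m} (-1)^i G[{1,…,m-1, m+i} | {m, m+1,…,n} \ {m+i}]` vanishes
(rows and columns taken in increasing order; indices here are 0-based, so the 1-based
rows `{1,…,m-1, m+i}` become `{0,…,m-2, m-1+i}` and the 1-based columns
`{m,…,n} \ {m+i}` become `{m-1,…,2m-1} \ {m-1+i}`). -/
theorem kronecker_pluecker_relation {R : Type*} [CommRing R] (m : ℕ) (hm : 1 ≤ m)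
    (G : Matrix (Fin (2 * m)) (Fin (2 * m)) R) (hG : ∀ i j, G i j = G j i) :
    ∑ i : Fin (m + 1), (-1 : R) ^ (i : ℕ) *
      Matrix.det (Matrix.of fun k l : Fin m =>
        G (if h : (k : ℕ) < m - 1 then ⟨k, by omega⟩ else ⟨m - 1 + i, by omega⟩)
          (if (l : ℕ) < (i : ℕ) then ⟨m - 1 + l, by omega⟩ else ⟨m + l, by omega⟩)) = 0 := by
  obtain ⟨p, rfl⟩ : ∃ p, m = p + 1 := ⟨m - 1, by omega⟩
  let c : Fin (p + 2) → Fin (2 * (p + 1)) := fun j => ⟨p + j, by omega⟩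
  rw [← sum_neg_one_pow_mul_det_append_row_eq_zero
    (Matrix.of fun k j => G ⟨k, by omega⟩ (c j)) (G.submatrix c c) fun i j => hG _ _]
  refine Fintype.sum_congr _ _ fun i => ?_
  congr 2
  ext k l
  have hcol : (if (l : ℕ) < (i : ℕ) then ⟨p + 1 - 1 + l, by omega⟩ else ⟨p + 1 + l, by omega⟩)
      = c (i.succAbove l) := by
    simp only [c, Fin.succAbove, Fin.lt_def, Fin.ext_iff, Fin.val_castSucc]
    split_ifs
    · simp
    · simp; omega
  simp only [Matrix.of_apply]
  rw [hcol]
  by_cases h : (k : ℕ) < p <;> simp [h, c]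
end

section
/- Let v = (v₁ ≥ v₂ ≥ … ≥ v_r ≥ 0) be a partition and N ≥ 0. Work in the field of rational functions over ℚ in indeterminates y₁,…,y_N, x₁, x₂, x₃, x₄. For 1 ≤ i < j ≤ 4 set z[i,j] := (x_i − x_j) · s_v(y₁,…,y_N, x_i, x_j), where s_v denotes the Schur polynomial in the N+2 listed variables. Then the Plücker relation holds: z[1,2]·z[3,4] − z[1,3]·z[2,4] + z[1,4]·z[2,3] = 0. -/
open Finset

/-- The Schur polynomial for a weakly increasing index vector `μ` of length `p`,
as `det(tᵢ^{μⱼ + j - 1}) / det(tᵢ^{j-1})` (0-indexed: `det(tᵢ^{μⱼ + j}) / det(tᵢ^j)`). -/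
noncomputable def schur {K : Type*} [Field K] {p : ℕ} (μ : Fin p → ℕ) (t : Fin p → K) : K :=
  Matrix.det (Matrix.of fun i j : Fin p => t i ^ (μ j + (j : ℕ))) /
    Matrix.det (Matrix.of fun i j : Fin p => t i ^ (j : ℕ))

/-- Pad a partition `v₁ ≥ v₂ ≥ … ≥ v_r` with zeros to length `p ≥ r` and rearrange
weakly increasingly: the resulting vector is `(0, …, 0, v_r, …, v₂, v₁)`. -/
def padIncr (r p : ℕ) (v : Fin r → ℕ) : Fin p → ℕ :=
  fun j => if h : p - 1 - (j : ℕ) < r then v ⟨p - 1 - (j : ℕ), h⟩ else 0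

/-- The field of rational functions over `ℚ` in `y₁,…,y_N, x₁, x₂, x₃, x₄`. -/
abbrev RatFunc1 (N : ℕ) : Type := FractionRing (MvPolynomial (Fin N ⊕ Fin 4) ℚ)

noncomputable def Y1 (N : ℕ) (i : Fin N) : RatFunc1 N :=
  algebraMap (MvPolynomial (Fin N ⊕ Fin 4) ℚ) _ (MvPolynomial.X (Sum.inl i))

noncomputable def X1 (N : ℕ) (i : Fin 4) : RatFunc1 N :=
  algebraMap (MvPolynomial (Fin N ⊕ Fin 4) ℚ) _ (MvPolynomial.X (Sum.inr i))

/-- `z[i,j] = (xᵢ - xⱼ) · s_v(y₁,…,y_N, xᵢ, xⱼ)`. -/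
noncomputable def z1 (N r : ℕ) (v : Fin r → ℕ) (i j : Fin 4) : RatFunc1 N :=
  (X1 N i - X1 N j) *
    schur (padIncr r (N + 2) v)
      (fun p : Fin (N + 2) =>
        if h : (p : ℕ) < N then Y1 N ⟨p, h⟩ else if (p : ℕ) = N then X1 N i else X1 N j)

/-- The three-term Plücker relation for determinants of matrices that agree outside
the two rows `p` and `q`. -/
theorem Matrix.det_updateRow_updateRow_pluecker {n R : Type*} [Fintype n] [DecidableEq n]
    [CommRing R] (M : Matrix n n R) {p q : n} (hpq : p ≠ q) (a b c d : n → R) :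
    ((M.updateRow p a).updateRow q b).det * ((M.updateRow p c).updateRow q d).det -
        ((M.updateRow p a).updateRow q c).det * ((M.updateRow p b).updateRow q d).det +
      ((M.updateRow p a).updateRow q d).det * ((M.updateRow p b).updateRow q c).det = 0 := by
  set P : Matrix n n R := (M.updateRow p a).updateRow q b with hP
  have hcomm (x y : n → R) :
      (M.updateRow p x).updateRow q y = (M.updateRow q y).updateRow p x :=
    Function.update_comm (β := fun _ => n → R) hpq x y M
  have hcramer : ∑ i, (P.updateRow i c).det • P i = P.det • c := by
    have h := Matrix.mulVec_cramer P.transpose c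
    rw [Matrix.det_transpose] at h
    rw [← h]
    ext j
    simp [Matrix.mulVec, dotProduct, Matrix.cramer_transpose_apply, mul_comm]
  let L : (n → R) →ₗ[R] R :=
    (Matrix.detRowAlternating (R := R) (n := n)).toMultilinearMap.toLinearMap
      (M.updateRow q d) p
  have hL (x : n → R) : L x = ((M.updateRow p x).updateRow q d).det := by
    rw [hcomm]; rfl
  have hPp : P p = a := by simp [hP, hpq]
  have hPq : P q = b := by simp [hP]
  have hzero (i : n) (hi : i ≠ p ∧ i ≠ q) : (P.updateRow i c).det • L (P i) = 0 := by
    have : L (P i) = 0 := by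
      rw [hL]
      refine Matrix.det_zero_of_row_eq hi.1 ?_
      simp [hP, hi.1, hi.2, hpq]
    rw [this, smul_zero]
  have hp : P.updateRow p c = (M.updateRow p c).updateRow q b := by
    rw [hP, hcomm, hcomm]
    exact Function.update_idem ..
  have hq : P.updateRow q c = (M.updateRow p a).updateRow q c := Function.update_idem ..
  have hswap : ((M.updateRow p c).updateRow q b).det =
      -((M.updateRow p b).updateRow q c).det := by
    have h := (Matrix.detRowAlternating (R := R) (n := n)).map_swap
      ((M.updateRow p b).updateRow q c) hpq
    refine Eq.trans (congrArg Matrix.det ?_) h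
    funext i
    change _ = ((M.updateRow p b).updateRow q c) (Equiv.swap p q i)
    rcases eq_or_ne i p with rfl | hip
    · simp [hpq]
    rcases eq_or_ne i q with rfl | hiq
    · simp [hpq]
    · simp [hip, hiq, Equiv.swap_apply_of_ne_of_ne hip hiq]
  have key := congrArg L hcramer
  rw [map_sum, map_smul] at key
  simp only [map_smul] at key
  rw [Fintype.sum_eq_add p q hpq hzero, hPp, hPq, hp, hq, hswap, hL, hL, hL] at key
  simp only [smul_eq_mul] at key
  linear_combination -key

/-- Splitting the last variable off a Vandermonde determinant. -/
theorem Matrix.det_vandermonde_snoc {R : Type*} [CommRing R] {n : ℕ} (y : Fin n → R) (a : R) :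
    (Matrix.vandermonde (Fin.snoc y a : Fin (n + 1) → R)).det =
      (Matrix.vandermonde y).det * ∏ i, (a - y i) := by
  have hswap (m : ℕ) (t : Fin m → R) :
      (Matrix.vandermonde t).det = ∏ j, ∏ i ∈ Iio j, (t j - t i) := by
    rw [Matrix.det_vandermonde]
    exact prod_comm' (by simp)
  rw [hswap, hswap, Fin.prod_univ_castSucc]
  simp [Fin.Iio_last_eq_map, Fin.Iio_castSucc, -Fin.map_castSuccEmb_Iio]

/-- The numerator of the Schur polynomial in the variables `y`, `a`, `b`. -/
noncomputable def schurNumerator {K : Type*} [Field K] {N : ℕ} (μ : Fin (N + 2) → ℕ)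
    (y : Fin N → K) (a b : K) : K :=
  Matrix.det (Matrix.of fun i j : Fin (N + 2) =>
    (Fin.snoc (Fin.snoc y a : Fin (N + 1) → K) b : Fin (N + 2) → K) i ^ (μ j + (j : ℕ)))

theorem schurNumerator_pluecker {K : Type*} [Field K] {N : ℕ} (μ : Fin (N + 2) → ℕ)
    (y : Fin N → K) (a b c d : K) :
    schurNumerator μ y a b * schurNumerator μ y c d -
        schurNumerator μ y a c * schurNumerator μ y b d +
      schurNumerator μ y a d * schurNumerator μ y b c = 0 := by
  let row (x : K) (j : Fin (N + 2)) : K := x ^ (μ j + (j : ℕ))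
  let M : Matrix (Fin (N + 2)) (Fin (N + 2)) K := Matrix.of fun i =>
    row ((Fin.snoc (Fin.snoc y 0 : Fin (N + 1) → K) 0 : Fin (N + 2) → K) i)
  have h (a b : K) : schurNumerator μ y a b =
      ((M.updateRow (Fin.last N).castSucc (row a)).updateRow (Fin.last (N + 1)) (row b)).det := by
    unfold schurNumerator
    congr 1
    ext i j
    induction i using Fin.lastCases with
    | last => simp [row]
    | cast i =>
      rw [Matrix.updateRow_ne (Fin.castSucc_lt_last i).ne]
      induction i using Fin.lastCases with
      | last => simp [row]
      | cast i =>
        rw [Matrix.updateRow_ne (by simp)]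
        simp [row, M]
  simp only [h]
  exact Matrix.det_updateRow_updateRow_pluecker M (Fin.castSucc_lt_last _).ne _ _ _ _

theorem sub_mul_schur_snoc_snoc {K : Type*} [Field K] {N : ℕ} (μ : Fin (N + 2) → ℕ)
    (y : Fin N → K) {a b : K} (hab : a ≠ b) :
    (a - b) * schur μ (Fin.snoc (Fin.snoc y a : Fin (N + 1) → K) b) =
      -schurNumerator μ y a b /
        ((Matrix.vandermonde y).det * (∏ i, (a - y i)) * ∏ i, (b - y i)) := by
  have hden : Matrix.det (Matrix.of fun i j : Fin (N + 2) =>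
      (Fin.snoc (Fin.snoc y a : Fin (N + 1) → K) b : Fin (N + 2) → K) i ^ (j : ℕ)) =
      (Matrix.vandermonde y).det * (∏ i, (a - y i)) * (∏ i, (b - y i)) * (b - a) := by
    rw [mul_assoc _ _ (b - a)]
    refine (Matrix.det_vandermonde_snoc _ b).trans ?_
    rw [Matrix.det_vandermonde_snoc, Fin.prod_univ_castSucc]
    simp
  have h : b - a ≠ 0 := sub_ne_zero.mpr hab.symm
  rw [schur, hden, ← schurNumerator, ← neg_sub b a, neg_mul, neg_div, ← mul_div_assoc,
    mul_comm (b - a), mul_div_mul_right _ _ h]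

theorem X1_injective (N : ℕ) : Function.Injective (X1 N) := fun i j h => by
  have := MvPolynomial.X_injective (IsFractionRing.injective _ _ h)
  simpa using this

theorem z1_eq (N r : ℕ) (v : Fin r → ℕ) {i j : Fin 4} (hij : i ≠ j) :
    z1 N r v i j = -schurNumerator (padIncr r (N + 2) v) (Y1 N) (X1 N i) (X1 N j) /
      ((Matrix.vandermonde (Y1 N)).det * (∏ k, (X1 N i - Y1 N k)) *
        ∏ k, (X1 N j - Y1 N k)) := by
  rw [← sub_mul_schur_snoc_snoc _ _ ((X1_injective N).ne hij), z1]
  congr 2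
  ext p
  induction p using Fin.lastCases with
  | last => simp
  | cast p =>
    induction p using Fin.lastCases with
    | last => simp
    | cast p => simp

/-- The quantities `z[i,j] = (xᵢ - xⱼ)·s_v(y₁,…,y_N, xᵢ, xⱼ)` satisfy the Plücker
relation `z[1,2]z[3,4] - z[1,3]z[2,4] + z[1,4]z[2,3] = 0`. -/
theorem schur_pluecker_relation (N r : ℕ) (v : Fin r → ℕ) (hv : Antitone v)
    (hr : r ≤ N + 2) :
    z1 N r v 0 1 * z1 N r v 2 3 - z1 N r v 0 2 * z1 N r v 1 3 +
        z1 N r v 0 3 * z1 N r v 1 2 = 0 := by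
  rw [z1_eq N r v (by decide : (0 : Fin 4) ≠ 1), z1_eq N r v (by decide : (2 : Fin 4) ≠ 3),
    z1_eq N r v (by decide : (0 : Fin 4) ≠ 2), z1_eq N r v (by decide : (1 : Fin 4) ≠ 3),
    z1_eq N r v (by decide : (0 : Fin 4) ≠ 3), z1_eq N r v (by decide : (1 : Fin 4) ≠ 2)]
  have key := schurNumerator_pluecker (padIncr r (N + 2) v) (Y1 N)
    (X1 N 0) (X1 N 1) (X1 N 2) (X1 N 3)
  simp only [div_eq_mul_inv, mul_inv]
  linear_combination ((Matrix.vandermonde (Y1 N)).det⁻¹ ^ 2 * (∏ k, (X1 N 0 - Y1 N k))⁻¹ *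
    (∏ k, (X1 N 1 - Y1 N k))⁻¹ * (∏ k, (X1 N 2 - Y1 N k))⁻¹ *
    (∏ k, (X1 N 3 - Y1 N k))⁻¹) * key
end

section
/- Let m ≥ 1 and n = 2m, and work in the field of rational functions over ℚ in indeterminates a₁,…,a_n, b₁,…,b_n, x₁,…,x_n. Then Pf( ((a_i − a_j)(b_i − b_j)) / (x_i² − x_j²) ) = ( ∏_{1≤i<j≤n} (x_i + x_j)/(x_i − x_j) ) · Pf( (a_i − a_j)/(x_i + x_j) ) · Pf( (b_i − b_j)/(x_i + x_j) ), where each Pf is the Pfaffian of the antisymmetric n × n matrix with the indicated (i,j) entry. -/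
open Finset

/-- The Pfaffian of a `2m × 2m` matrix: the sum over all permutations `σ` with
`σ(2i-1) < σ(2i)` for each `i` and `σ(1) < σ(3) < ⋯ < σ(2m-1)` (1-indexed). -/
def pfaffian {R : Type*} [CommRing R] (m : ℕ) (M : Matrix (Fin (2 * m)) (Fin (2 * m)) R) : R :=
  ∑ σ : Equiv.Perm (Fin (2 * m)),
    if (∀ i : Fin m, σ ⟨2 * i.val, by omega⟩ < σ ⟨2 * i.val + 1, by omega⟩) ∧
       (∀ i j : Fin m, i < j → σ ⟨2 * i.val, by omega⟩ < σ ⟨2 * j.val, by omega⟩)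
    then ((Equiv.Perm.sign σ : ℤ) : R) *
      ∏ i : Fin m, M (σ ⟨2 * i.val, by omega⟩) (σ ⟨2 * i.val + 1, by omega⟩)
    else 0

/-- The field of rational functions over `ℚ` in `aᵢ, bᵢ, xᵢ`, `1 ≤ i ≤ n`. -/
abbrev RatFunc8 (n : ℕ) : Type :=
  FractionRing (MvPolynomial (Fin n ⊕ Fin n ⊕ Fin n) ℚ)

noncomputable def A8 (n : ℕ) (i : Fin n) : RatFunc8 n :=
  algebraMap (MvPolynomial (Fin n ⊕ Fin n ⊕ Fin n) ℚ) _ (MvPolynomial.X (Sum.inl i))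

noncomputable def B8 (n : ℕ) (i : Fin n) : RatFunc8 n :=
  algebraMap (MvPolynomial (Fin n ⊕ Fin n ⊕ Fin n) ℚ) _ (MvPolynomial.X (Sum.inr (Sum.inl i)))

noncomputable def X8 (n : ℕ) (i : Fin n) : RatFunc8 n :=
  algebraMap (MvPolynomial (Fin n ⊕ Fin n ⊕ Fin n) ℚ) _ (MvPolynomial.X (Sum.inr (Sum.inr i)))


section PfaffianExpansion

/-- The permutation of `Fin (n + 2)` fixing `0`, sending `1` to `j + 1`, and acting as `τ`
(order-preservingly relabelled) on the remaining elements. -/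
def pairExtend {n : ℕ} (j : Fin (n + 1)) (τ : Equiv.Perm (Fin n)) : Equiv.Perm (Fin (n + 2)) :=
  Equiv.Perm.decomposeFin.symm
    (0, (Fin.cycleRange j)⁻¹ * Equiv.Perm.decomposeFin.symm (0, τ))

lemma pairExtend_zero {n : ℕ} (j : Fin (n + 1)) (τ : Equiv.Perm (Fin n)) :
    pairExtend j τ 0 = 0 := by
  simp [pairExtend]

lemma pairExtend_one {n : ℕ} (j : Fin (n + 1)) (τ : Equiv.Perm (Fin n)) :
    pairExtend j τ (Fin.succ 0) = j.succ := by
  simp only [pairExtend, Equiv.Perm.decomposeFin_symm_apply_succ]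
  simp [Equiv.Perm.inv_def]

lemma pairExtend_succ_succ {n : ℕ} (j : Fin (n + 1)) (τ : Equiv.Perm (Fin n)) (k : Fin n) :
    pairExtend j τ k.succ.succ = (j.succAbove (τ k)).succ := by
  simp only [pairExtend, Equiv.Perm.decomposeFin_symm_apply_succ]
  simp [Equiv.Perm.inv_def]

lemma sign_pairExtend {n : ℕ} (j : Fin (n + 1)) (τ : Equiv.Perm (Fin n)) :
    Equiv.Perm.sign (pairExtend j τ) = (-1) ^ (j : ℕ) * Equiv.Perm.sign τ := by
  simp [pairExtend]

lemma exists_pairExtend {n : ℕ} (σ : Equiv.Perm (Fin (n + 2))) (h : σ 0 = 0) :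
    ∃ (j : Fin (n + 1)) (τ : Equiv.Perm (Fin n)), pairExtend j τ = σ := by
  obtain ⟨⟨p, π⟩, rfl⟩ := Equiv.Perm.decomposeFin.symm.surjective σ
  obtain rfl : p = 0 := by simpa using h
  obtain ⟨⟨q, τ⟩, hq⟩ := Equiv.Perm.decomposeFin.symm.surjective (Fin.cycleRange (π 0) * π)
  obtain rfl : q = 0 := by
    have := congrArg (fun e : Equiv.Perm (Fin (n + 1)) => e 0) hq
    simpa using this
  exact ⟨π 0, τ, by simp [pairExtend, hq]⟩

lemma pairExtend_injective {n : ℕ} :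
    Function.Injective fun p : Fin (n + 1) × Equiv.Perm (Fin n) => pairExtend p.1 p.2 := by
  rintro ⟨j, τ⟩ ⟨j', τ'⟩ h
  have hj : j = j' := by
    have := congrArg (fun e : Equiv.Perm (Fin (n + 2)) => e (Fin.succ 0)) h
    simpa only [pairExtend_one, Fin.succ_inj] using this
  subst hj
  have hτ : τ = τ' := by
    ext1 k
    have := congrArg (fun e : Equiv.Perm (Fin (n + 2)) => e k.succ.succ) h
    simpa only [pairExtend_succ_succ, Fin.succ_inj, Fin.succAbove_right_inj] using this
  rw [hτ]

/-- A sum over permutations whose terms vanish unless `0` is fixed. -/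
lemma sum_perm_eq_sum_pairExtend {R : Type*} [AddCommMonoid R] {n : ℕ}
    (f : Equiv.Perm (Fin (n + 2)) → R) (hf : ∀ σ, σ 0 ≠ 0 → f σ = 0) :
    ∑ σ, f σ = ∑ j : Fin (n + 1), ∑ τ : Equiv.Perm (Fin n), f (pairExtend j τ) := by
  rw [← Fintype.sum_prod_type' (f := fun j τ => f (pairExtend j τ))]
  symm
  refine Finset.sum_of_injOn (fun p => pairExtend p.1 p.2) pairExtend_injective.injOn
    (by simp) ?_ (by simp)
  intro σ _ hσ
  refine hf σ fun h0 => hσ ?_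
  obtain ⟨j, τ, h⟩ := exists_pairExtend σ h0
  exact ⟨(j, τ), by simp, h⟩

/-- The ordering condition on the permutations that index the Pfaffian. -/
def IsPairing (m : ℕ) (σ : Equiv.Perm (Fin (2 * m))) : Prop :=
  (∀ i : Fin m, σ ⟨2 * i.val, by omega⟩ < σ ⟨2 * i.val + 1, by omega⟩) ∧
    ∀ i j : Fin m, i < j → σ ⟨2 * i.val, by omega⟩ < σ ⟨2 * j.val, by omega⟩

lemma IsPairing.apply_zero {m : ℕ} {σ : Equiv.Perm (Fin (2 * m + 2))}
    (h : IsPairing (m + 1) σ) : σ 0 = 0 := by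
  obtain ⟨c, hc⟩ := σ.surjective 0
  obtain ⟨c, hlt⟩ := c
  have key : ∀ i : Fin (m + 1), σ 0 ≤ σ ⟨2 * i.val, by omega⟩ := by
    intro i
    rcases Fin.eq_zero_or_eq_succ i with rfl | ⟨k, rfl⟩
    · exact le_rfl
    · have h0 : (⟨2 * (0 : Fin (m + 1)).val, by simp⟩ : Fin (2 * m + 2)) = 0 := Fin.ext (by simp)
      have := h.2 0 k.succ (Fin.succ_pos k)
      rw [← h0]
      exact this.le
  rcases Nat.even_or_odd' c with ⟨k, rfl | rfl⟩
  · have := key ⟨k, by omega⟩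
    simp only [hc] at this
    exact le_antisymm this (Fin.zero_le _)
  · have := h.1 ⟨k, by omega⟩
    have h2 : σ ⟨2 * k, by omega⟩ < σ ⟨2 * k + 1, hlt⟩ := this
    rw [hc] at h2
    exact absurd h2 (Fin.not_lt_zero _)

lemma pairExtend_even {m : ℕ} (j : Fin (2 * m + 1)) (τ : Equiv.Perm (Fin (2 * m)))
    (k : Fin m) (h : 2 * (k.succ : Fin (m + 1)).val < 2 * m + 2) :
    pairExtend j τ ⟨2 * (k.succ : Fin (m + 1)).val, h⟩ =
      (j.succAbove (τ ⟨2 * k.val, by omega⟩)).succ :=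
  pairExtend_succ_succ j τ ⟨2 * k.val, by omega⟩

lemma pairExtend_odd {m : ℕ} (j : Fin (2 * m + 1)) (τ : Equiv.Perm (Fin (2 * m)))
    (k : Fin m) (h : 2 * (k.succ : Fin (m + 1)).val + 1 < 2 * m + 2) :
    pairExtend j τ ⟨2 * (k.succ : Fin (m + 1)).val + 1, h⟩ =
      (j.succAbove (τ ⟨2 * k.val + 1, by omega⟩)).succ :=
  pairExtend_succ_succ j τ ⟨2 * k.val + 1, by omega⟩

lemma pairExtend_mk_zero {m : ℕ} (j : Fin (2 * m + 1)) (τ : Equiv.Perm (Fin (2 * m)))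
    (h : 2 * (0 : Fin (m + 1)).val < 2 * m + 2) :
    pairExtend j τ ⟨2 * (0 : Fin (m + 1)).val, h⟩ = 0 :=
  pairExtend_zero j τ

lemma pairExtend_mk_one {m : ℕ} (j : Fin (2 * m + 1)) (τ : Equiv.Perm (Fin (2 * m)))
    (h : 2 * (0 : Fin (m + 1)).val + 1 < 2 * m + 2) :
    pairExtend j τ ⟨2 * (0 : Fin (m + 1)).val + 1, h⟩ = j.succ :=
  pairExtend_one j τ

lemma isPairing_succ_iff {m : ℕ} (σ : Equiv.Perm (Fin (2 * m + 2))) :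
    IsPairing (m + 1) σ ↔
      (∀ i : Fin (m + 1), σ ⟨2 * i.val, by omega⟩ < σ ⟨2 * i.val + 1, by omega⟩) ∧
        ∀ i j : Fin (m + 1), i < j → σ ⟨2 * i.val, by omega⟩ < σ ⟨2 * j.val, by omega⟩ :=
  Iff.rfl

lemma isPairing_pairExtend {m : ℕ} (j : Fin (2 * m + 1)) (τ : Equiv.Perm (Fin (2 * m))) :
    IsPairing (m + 1) (pairExtend j τ) ↔ IsPairing m τ := by
  rw [isPairing_succ_iff, Fin.forall_fin_succ]
  simp only [Fin.forall_fin_succ (n := m), pairExtend_mk_zero, pairExtend_mk_one, pairExtend_even,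
    pairExtend_odd, Fin.succ_pos, Fin.succ_lt_succ_iff, Fin.succAbove_lt_succAbove_iff,
    Fin.not_lt_zero, IsPairing, true_and, false_imp_iff, implies_true]

open Classical in
lemma pfaffian_eq_sum_isPairing {R : Type*} [CommRing R] (m : ℕ)
    (M : Matrix (Fin (2 * m)) (Fin (2 * m)) R) :
    pfaffian m M = ∑ σ : Equiv.Perm (Fin (2 * m)),
      if IsPairing m σ then ((Equiv.Perm.sign σ : ℤ) : R) *
        ∏ i : Fin m, M (σ ⟨2 * i.val, by omega⟩) (σ ⟨2 * i.val + 1, by omega⟩) else 0 := by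
  unfold pfaffian
  refine Finset.sum_congr rfl fun σ _ => ?_
  exact if_congr Iff.rfl rfl rfl

/-- Expansion of the Pfaffian along its first row. -/
lemma pfaffian_succ {R : Type*} [CommRing R] (m : ℕ)
    (M : Matrix (Fin (2 * m + 2)) (Fin (2 * m + 2)) R) :
    pfaffian (m + 1) M = ∑ j : Fin (2 * m + 1), (-1) ^ (j : ℕ) * M 0 j.succ *
      pfaffian m (M.submatrix (fun k => (j.succAbove k).succ) fun k => (j.succAbove k).succ) := by
  classical
  rw [pfaffian_eq_sum_isPairing]
  refine (sum_perm_eq_sum_pairExtend (n := 2 * m) _ ?_).trans ?_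
  · intro σ hσ
    exact if_neg fun h => hσ h.apply_zero
  · refine Finset.sum_congr rfl fun j _ => ?_
    rw [pfaffian_eq_sum_isPairing, Finset.mul_sum]
    refine Finset.sum_congr rfl fun τ _ => ?_
    rw [mul_ite, mul_zero]
    refine if_congr (isPairing_pairExtend j τ) ?_ rfl
    rw [Fin.prod_univ_succ]
    erw [sign_pairExtend, pairExtend_mk_zero, pairExtend_mk_one]
    have : ∀ i : Fin m,
        M (pairExtend j τ ⟨2 * (i.succ : Fin (m + 1)).val, by omega⟩)
          (pairExtend j τ ⟨2 * (i.succ : Fin (m + 1)).val + 1, by omega⟩) =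
        M.submatrix (fun k => (j.succAbove k).succ) (fun k => (j.succAbove k).succ)
          (τ ⟨2 * i.val, by omega⟩) (τ ⟨2 * i.val + 1, by omega⟩) := by
      intro i
      rw [pairExtend_even, pairExtend_odd]
      rfl
    erw [Finset.prod_congr rfl fun i _ => this i]
    push_cast
    ring

end PfaffianExpansion

section Difference

/-- The product of differences `∏_{i<j} (yᵢ - yⱼ)`. -/
def diffProd {K : Type*} [CommRing K] {n : ℕ} (y : Fin n → K) : K :=
  ∏ i, ∏ j, if i < j then y i - y j else 1

lemma prod_succAbove_lt_neg_one {K : Type*} [CommRing K] {n : ℕ} (j : Fin (n + 1)) :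
    ∏ k : Fin n, (if j.succAbove k < j then (-1 : K) else 1) = (-1) ^ (j : ℕ) := by
  simp only [Fin.succAbove_lt_iff_castSucc_lt]
  rw [Finset.prod_ite, Finset.prod_const, Finset.prod_const_one, mul_one]
  congr 1
  have : (Finset.univ.filter fun k : Fin n => k.castSucc < j).map Fin.castSuccEmb =
      Finset.Iio j := by
    ext c
    simp only [Finset.mem_map, Finset.mem_filter, Finset.mem_univ, true_and, Finset.mem_Iio]
    constructor
    · rintro ⟨k, hk, rfl⟩
      exact hk
    · intro hc
      exact ⟨c.castLT (by omega), by simpa using hc, by simp⟩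
  rw [← Finset.card_map Fin.castSuccEmb, this, Fin.card_Iio]

lemma diffProd_succAbove {K : Type*} [CommRing K] {n : ℕ} (y : Fin (n + 1) → K)
    (j : Fin (n + 1)) :
    diffProd y = (-1) ^ (j : ℕ) * (∏ k, (y j - y (j.succAbove k))) *
      diffProd fun k => y (j.succAbove k) := by
  unfold diffProd
  rw [Fin.prod_univ_succAbove _ j]
  simp only [Fin.prod_univ_succAbove _ j, lt_irrefl, if_false, one_mul,
    Fin.succAbove_lt_succAbove_iff, Finset.prod_mul_distrib]
  rw [← prod_succAbove_lt_neg_one j]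
  simp only [← mul_assoc, ← Finset.prod_mul_distrib]
  refine Finset.prod_congr rfl fun k _ => ?_
  congr 1
  rcases lt_or_gt_of_ne (Fin.succAbove_ne j k) with h | h
  · simp [h, h.not_gt]
  · simp [h, h.not_gt]

lemma diffProd_cons {K : Type*} [CommRing K] {n : ℕ} (z : K) (y : Fin n → K) :
    diffProd (Fin.cons z y : Fin (n + 1) → K) = (∏ k, (z - y k)) * diffProd y := by
  rw [diffProd_succAbove _ 0]
  simp

lemma diffProd_ne_zero {K : Type*} [Field K] {n : ℕ} {y : Fin n → K}
    (hy : Function.Injective y) : diffProd y ≠ 0 := by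
  unfold diffProd
  simp only [Finset.prod_ne_zero_iff]
  intro i _ j _
  split_ifs with h
  · exact sub_ne_zero.2 (hy.ne h.ne)
  · exact one_ne_zero

end Difference

section InterleavedVandermonde

open Polynomial

/-- The matrix with rows `(1, aᵢ, xᵢ, aᵢ xᵢ, xᵢ², aᵢ xᵢ², …)`. -/
def interleavedVandermonde {K : Type*} [CommRing K] {n : ℕ} (x a : Fin n → K) :
    Matrix (Fin n) (Fin n) K :=
  Matrix.of fun i c => x i ^ ((c : ℕ) / 2) * a i ^ ((c : ℕ) % 2)

lemma interleavedVandermonde_sq_self {K : Type*} [CommRing K] {n : ℕ} (x : Fin n → K) :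
    interleavedVandermonde (fun i => x i ^ 2) x = Matrix.vandermonde x := by
  ext i c
  simp only [interleavedVandermonde, Matrix.of_apply, Matrix.vandermonde_apply]
  rw [← pow_mul, ← pow_add, Nat.div_add_mod]

lemma det_vandermonde_sq {K : Type*} [CommRing K] {n : ℕ} (x : Fin n → K) :
    (Matrix.vandermonde x).det ^ 2 = diffProd x ^ 2 := by
  rw [Matrix.det_vandermonde, diffProd]
  simp only [← Finset.prod_pow]
  refine Finset.prod_congr rfl fun i _ => ?_
  rw [Finset.prod_pow, ← Finset.prod_pow, ← Finset.filter_lt_eq_Ioi, Finset.prod_filter]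
  refine Finset.prod_congr rfl fun j _ => ?_
  split_ifs <;> ring

/-- Column operations subtracting `t` times the column two places to the left. -/
lemma det_interleavedVandermonde_sub {K : Type*} [CommRing K] {n : ℕ}
    (x a : Fin (n + 2) → K) (t : K) :
    (interleavedVandermonde x a).det =
      (Matrix.of fun i : Fin (n + 2) => (Fin.cons 1 (Fin.cons (a i) fun k : Fin n =>
        (x i - t) * (x i ^ ((k : ℕ) / 2) * a i ^ ((k : ℕ) % 2)) : Fin (n + 1) → K) :
          Fin (n + 2) → K)).det := by
  set U : Matrix (Fin (n + 2)) (Fin (n + 2)) K := Matrix.of fun c d =>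
    (if c = d then 1 else 0) + if (c : ℕ) + 2 = d then -t else 0 with hU
  have hdet : U.det = 1 := by
    rw [Matrix.det_of_isUpperTriangular]
    · refine Finset.prod_eq_one fun i _ => ?_
      simp [hU]
    · intro i j hij
      have hij' : (j : ℕ) < i := hij
      have h1 : i ≠ j := by rintro rfl; omega
      have h2 : ¬ ((i : ℕ) + 2 = j) := by omega
      simp [hU, h1, h2]
  have hmul : (interleavedVandermonde x a).det = (interleavedVandermonde x a * U).det := by
    rw [Matrix.det_mul, hdet, mul_one]
  rw [hmul]
  congr 1
  ext i c
  simp only [Matrix.mul_apply, hU, Matrix.of_apply, mul_add, mul_ite, mul_one, mul_zero,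
    Finset.sum_add_distrib, Finset.sum_ite_eq', Finset.mem_univ, if_true]
  refine Fin.cases ?_ (fun c => ?_) c
  · simp [interleavedVandermonde]
  refine Fin.cases ?_ (fun c => ?_) c
  · simp [interleavedVandermonde]
  · have : ∀ d : Fin (n + 2), ((d : ℕ) + 2 = (c.succ.succ : Fin (n + 2))) ↔
        d = c.castSucc.castSucc := by
      intro d
      simp [Fin.ext_iff]
    simp only [this, Finset.sum_ite_eq', Finset.mem_univ, if_true, Fin.cons_succ]
    simp only [interleavedVandermonde, Matrix.of_apply, Fin.val_succ, Fin.val_castSucc]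
    rw [show (c : ℕ) + 1 + 1 = c + 2 from rfl, Nat.add_div_right _ two_pos, Nat.add_mod_right]
    ring

lemma det_interleavedVandermonde_cons_self {K : Type*} [CommRing K] {n : ℕ}
    (y a : Fin (n + 1) → K) (z : K) (j : Fin (n + 1)) :
    (interleavedVandermonde (Fin.cons (y j) y) (Fin.cons z a : Fin (n + 2) → K)).det =
      (-1) ^ (j : ℕ) * (a j - z) * (∏ k, (y (j.succAbove k) - y j)) *
        (interleavedVandermonde (fun k => y (j.succAbove k)) fun k => a (j.succAbove k)).det := by
  rw [det_interleavedVandermonde_sub _ _ (y j), Matrix.det_succ_row_zero, Fin.sum_univ_succ,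
    Fin.sum_univ_succ]
  simp only [Matrix.of_apply, Fin.cons_zero, Fin.cons_succ, sub_self, zero_mul, mul_zero,
    Finset.sum_const_zero, add_zero]
  rw [Matrix.det_succ_row _ j, Matrix.det_succ_row _ j, Fin.sum_univ_succ, Fin.sum_univ_succ]
  have key : ∀ N : Matrix (Fin n) (Fin n) K, (∀ i k, N i k = (y (j.succAbove i) - y j) *
      (y (j.succAbove i) ^ ((k : ℕ) / 2) * a (j.succAbove i) ^ ((k : ℕ) % 2))) →
      N.det = (∏ k, (y (j.succAbove k) - y j)) *
        (interleavedVandermonde (fun k => y (j.succAbove k)) fun k => a (j.succAbove k)).det := by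
    intro N hN
    rw [← Matrix.det_mul_column]
    congr 1
    ext i k
    exact hN i k
  simp only [Matrix.submatrix_apply, Matrix.submatrix_submatrix, Matrix.of_apply, Fin.cons_succ,
    Fin.zero_succAbove, Fin.cons_zero, Fin.succ_succAbove_zero, Fin.succ_succAbove_succ,
    sub_self, zero_mul, mul_zero, Finset.sum_const_zero, add_zero]
  rw [key (Matrix.submatrix _ _ _), key (Matrix.submatrix _ _ _)]
  · simp
    ring
  · intro i k
    simp
  · intro i k
    simp

/-- `det (interleavedVandermonde x a)` as a polynomial in the first entry of `x`. -/
lemma exists_polynomial_det_interleavedVandermonde {K : Type*} [Field K] {m : ℕ}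
    (y : Fin (2 * m + 1) → K) (a : Fin (2 * m + 2) → K) :
    ∃ p : K[X], p.natDegree ≤ m ∧
      ∀ z, p.eval z = (interleavedVandermonde (Fin.cons z y : Fin (2 * m + 2) → K) a).det := by
  refine ⟨∑ c : Fin (2 * m + 2), C ((-1) ^ (c : ℕ) * a 0 ^ ((c : ℕ) % 2) *
    ((interleavedVandermonde (Fin.cons 0 y : Fin (2 * m + 2) → K) a).submatrix Fin.succ
      c.succAbove).det) * X ^ ((c : ℕ) / 2), ?_, ?_⟩
  · refine natDegree_sum_le_of_forall_le _ _ fun c _ => (natDegree_C_mul_X_pow_le _ _).trans ?_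
    omega
  · intro z
    rw [Matrix.det_succ_row_zero, eval_finsetSum]
    refine Finset.sum_congr rfl fun c _ => ?_
    have : (interleavedVandermonde (Fin.cons 0 y : Fin (2 * m + 2) → K) a).submatrix Fin.succ
        c.succAbove = (interleavedVandermonde (Fin.cons z y : Fin (2 * m + 2) → K) a).submatrix
          Fin.succ c.succAbove := by
      ext i k
      simp [interleavedVandermonde]
    rw [this]
    simp only [eval_mul, eval_C, eval_pow, eval_X]
    simp only [interleavedVandermonde, Matrix.of_apply, Fin.cons_zero]
    ring

lemma prod_sub_mul_basis_eval {K : Type*} [Field K] {n : ℕ} {y : Fin (n + 1) → K}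
    (hy : Function.Injective y) (j : Fin (n + 1)) (z : K) :
    (∏ k, (y j - y (j.succAbove k))) * (Lagrange.basis Finset.univ y j).eval z =
      ∏ k, (z - y (j.succAbove k)) := by
  have : Finset.univ.erase j = Finset.univ.map (Fin.succAboveEmb j) := by
    ext k
    simp only [Finset.mem_erase, Finset.mem_univ, and_true, Finset.mem_map, true_and,
      Fin.coe_succAboveEmb, Fin.exists_succAbove_eq_iff]
  rw [Lagrange.basis, this, Finset.prod_map, eval_prod, ← Finset.prod_mul_distrib]
  refine Finset.prod_congr rfl fun k _ => ?_
  have h : y j - y (j.succAbove k) ≠ 0 := sub_ne_zero.2 (hy.ne (Fin.succAbove_ne j k).symm)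
  simp [Lagrange.basisDivisor]
  field_simp

/-- Okada's Pfaffian identity
`Pf((aᵢ - aⱼ)(bᵢ - bⱼ)/(xᵢ - xⱼ)) = det V(x; a) det V(x; b) / ∏_{i<j} (xᵢ - xⱼ)`. -/
theorem pfaffian_mul_diffProd {K : Type*} [Field K] (m : ℕ) (x a b : Fin (2 * m) → K)
    (hx : Function.Injective x) :
    pfaffian m (Matrix.of fun i j => (a i - a j) * (b i - b j) / (x i - x j)) * diffProd x =
      (interleavedVandermonde x a).det * (interleavedVandermonde x b).det := by
  induction m with
  | zero => simp [pfaffian, diffProd, Matrix.det_isEmpty]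
  | succ m ih =>
    change Fin (2 * m + 2) → K at x a b
    obtain ⟨z, y, rfl⟩ : ∃ (z : K) (y : Fin (2 * m + 1) → K), x = Fin.cons z y :=
      ⟨x 0, Fin.tail x, (Fin.cons_self_tail x).symm⟩
    obtain ⟨a₀, a, rfl⟩ : ∃ (z : K) (y : Fin (2 * m + 1) → K), a = Fin.cons z y :=
      ⟨a 0, Fin.tail a, (Fin.cons_self_tail a).symm⟩
    obtain ⟨b₀, b, rfl⟩ : ∃ (z : K) (y : Fin (2 * m + 1) → K), b = Fin.cons z y :=
      ⟨b 0, Fin.tail b, (Fin.cons_self_tail b).symm⟩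
    have hy : Function.Injective y := (Fin.cons_injective_iff.1 hx).2
    have hz : ∀ j, z - y j ≠ 0 := fun j => sub_ne_zero.2 fun h =>
      (Fin.cons_injective_iff.1 hx).1 ⟨j, h.symm⟩
    obtain ⟨p, hp, hpe⟩ := exists_polynomial_det_interleavedVandermonde y (Fin.cons a₀ a)
    obtain ⟨q, hq, hqe⟩ := exists_polynomial_det_interleavedVandermonde y (Fin.cons b₀ b)
    have hdeg : (p * q).degree < (Finset.univ : Finset (Fin (2 * m + 1))).card := by
      refine lt_of_le_of_lt degree_le_natDegree ?_
      have := natDegree_mul_le (p := p) (q := q)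
      rw [Finset.card_fin]
      exact_mod_cast (by omega : (p * q).natDegree < 2 * m + 1)
    have hL := congrArg (eval z) (Lagrange.eq_interpolate (v := y) hy.injOn hdeg)
    rw [Lagrange.interpolate_apply, eval_finsetSum, eval_mul, hpe, hqe] at hL
    refine Eq.trans ?_ hL.symm
    rw [pfaffian_succ, Finset.sum_mul]
    refine Finset.sum_congr rfl fun j _ => ?_
    have ihj := ih (fun k => y (j.succAbove k)) (fun k => a (j.succAbove k))
      (fun k => b (j.succAbove k)) (hy.comp Fin.succAbove_right_injective)
    have hB := prod_sub_mul_basis_eval hy j z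
    rw [eval_mul, eval_C, eval_mul, hpe, hqe, det_interleavedVandermonde_cons_self,
      det_interleavedVandermonde_cons_self]
    have hneg : ∏ k, (y (j.succAbove k) - y j) = ∏ k, (y j - y (j.succAbove k)) := by
      have : ∀ k, y (j.succAbove k) - y j = -1 * (y j - y (j.succAbove k)) := fun k => by ring
      rw [Finset.prod_congr rfl fun k _ => this k, Finset.prod_mul_distrib, Finset.prod_const,
        Finset.card_fin, pow_mul, neg_one_sq, one_pow, one_mul]
    have hD : diffProd (Fin.cons z y : Fin (2 * m + 2) → K) = (z - y j) *
        (∏ k, (z - y (j.succAbove k))) * ((-1) ^ (j : ℕ) * (∏ k, (y j - y (j.succAbove k))) *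
          diffProd fun k => y (j.succAbove k)) := by
      rw [diffProd_cons, Fin.prod_univ_succAbove _ j, diffProd_succAbove y j]
    have hsub : (Matrix.of fun i k : Fin (2 * m + 2) =>
        ((Fin.cons a₀ a : Fin (2 * m + 2) → K) i - (Fin.cons a₀ a : Fin (2 * m + 2) → K) k) *
        ((Fin.cons b₀ b : Fin (2 * m + 2) → K) i - (Fin.cons b₀ b : Fin (2 * m + 2) → K) k) /
        ((Fin.cons z y : Fin (2 * m + 2) → K) i - (Fin.cons z y : Fin (2 * m + 2) → K) k)).submatrix
          (fun k => (j.succAbove k).succ) (fun k => (j.succAbove k).succ) =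
        Matrix.of fun i k => (a (j.succAbove i) - a (j.succAbove k)) *
          (b (j.succAbove i) - b (j.succAbove k)) / (y (j.succAbove i) - y (j.succAbove k)) := by
      ext i k
      simp
    erw [hsub, hD]
    simp only [Matrix.of_apply, Fin.cons_zero, Fin.cons_succ]
    rw [hneg, ← hB]
    have hzj := hz j
    field_simp
    linear_combination ((a₀ - a j) * (b₀ - b j) *
      (∏ k, (y j - y (j.succAbove k))) ^ 2 * eval z (Lagrange.basis Finset.univ y j)) * ihj

end InterleavedVandermonde

lemma diffProd_sq {K : Type*} [CommRing K] {n : ℕ} (x : Fin n → K) :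
    diffProd (fun i => x i ^ 2) =
      diffProd x * ∏ i, ∏ j, if i < j then x i + x j else 1 := by
  simp only [diffProd, ← Finset.prod_mul_distrib]
  refine Finset.prod_congr rfl fun i _ => Finset.prod_congr rfl fun j _ => ?_
  split_ifs <;> ring

lemma pfaffian_okada_factorization_of_injective {K : Type*} [Field K] (m : ℕ)
    (x a b : Fin (2 * m) → K) (hx : Function.Injective fun i => x i ^ 2) :
    pfaffian m (Matrix.of fun i j => (a i - a j) * (b i - b j) / (x i ^ 2 - x j ^ 2)) =
      (∏ i, ∏ j, if i < j then (x i + x j) / (x i - x j) else 1) *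
        pfaffian m (Matrix.of fun i j => (a i - a j) / (x i + x j)) *
        pfaffian m (Matrix.of fun i j => (b i - b j) / (x i + x j)) := by
  have hx' : Function.Injective x := fun i j h => hx (by simp [h])
  have hmat : ∀ c : Fin (2 * m) → K,
      (Matrix.of fun i j => (c i - c j) / (x i + x j)) =
        Matrix.of fun i j => (c i - c j) * (x i - x j) / (x i ^ 2 - x j ^ 2) := by
    intro c
    ext i j
    simp only [Matrix.of_apply]
    rcases eq_or_ne i j with rfl | h
    · simp
    · rw [sq_sub_sq, mul_div_mul_right _ _ (sub_ne_zero.2 (hx'.ne h))]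
  have hS := diffProd_sq x
  have h2 : diffProd (fun i => x i ^ 2) ≠ 0 := diffProd_ne_zero hx
  have h1 : diffProd x ≠ 0 := diffProd_ne_zero hx'
  have hprod : (∏ i, ∏ j, if i < j then (x i + x j) / (x i - x j) else 1) =
      diffProd (fun i => x i ^ 2) / diffProd x ^ 2 := by
    rw [hS, pow_two, mul_div_mul_left _ _ h1]
    simp only [diffProd, ← Finset.prod_div_distrib]
    refine Finset.prod_congr rfl fun i _ => Finset.prod_congr rfl fun j _ => ?_
    split_ifs <;> simp
  have hab := pfaffian_mul_diffProd m (fun i => x i ^ 2) a b hx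
  have ha := pfaffian_mul_diffProd m (fun i => x i ^ 2) a x hx
  have hb := pfaffian_mul_diffProd m (fun i => x i ^ 2) b x hx
  have hV := det_vandermonde_sq x
  rw [interleavedVandermonde_sq_self] at ha hb
  rw [hmat a, hmat b, hprod]
  rw [← eq_div_iff h2] at hab ha hb
  rw [hab, ha, hb]
  field_simp
  rw [hV]

lemma X8_sq_injective (n : ℕ) : Function.Injective fun i => X8 n i ^ 2 := by
  intro i j h
  by_contra hij
  have h' : (MvPolynomial.X (Sum.inr (Sum.inr i)) : MvPolynomial (Fin n ⊕ Fin n ⊕ Fin n) ℚ) ^ 2 =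
      MvPolynomial.X (Sum.inr (Sum.inr j)) ^ 2 := by
    apply IsFractionRing.injective (MvPolynomial (Fin n ⊕ Fin n ⊕ Fin n) ℚ) (RatFunc8 n)
    rw [map_pow, map_pow]
    exact h
  have := congrArg (MvPolynomial.eval fun s => if s = Sum.inr (Sum.inr i) then (1 : ℚ) else 0) h'
  simp [Ne.symm hij] at this

/-- Okada's factorization:
`Pf((aᵢ-aⱼ)(bᵢ-bⱼ)/(xᵢ²-xⱼ²)) = ∏_{i<j} (xᵢ+xⱼ)/(xᵢ-xⱼ) · Pf((aᵢ-aⱼ)/(xᵢ+xⱼ)) · Pf((bᵢ-bⱼ)/(xᵢ+xⱼ))`. -/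
theorem pfaffian_okada_factorization (m : ℕ) (hm : 1 ≤ m) :
    pfaffian m (Matrix.of fun i j : Fin (2 * m) =>
        ((A8 (2 * m) i - A8 (2 * m) j) * (B8 (2 * m) i - B8 (2 * m) j)) /
          (X8 (2 * m) i ^ 2 - X8 (2 * m) j ^ 2))
      = (∏ i : Fin (2 * m), ∏ j : Fin (2 * m),
            if i < j then (X8 (2 * m) i + X8 (2 * m) j) / (X8 (2 * m) i - X8 (2 * m) j) else 1) *
          pfaffian m (Matrix.of fun i j : Fin (2 * m) =>
            (A8 (2 * m) i - A8 (2 * m) j) / (X8 (2 * m) i + X8 (2 * m) j)) *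
          pfaffian m (Matrix.of fun i j : Fin (2 * m) =>
            (B8 (2 * m) i - B8 (2 * m) j) / (X8 (2 * m) i + X8 (2 * m) j)) := by
  exact pfaffian_okada_factorization_of_injective m _ _ _ (X8_sq_injective _)
end

section
/- Let m ≥ 1, n = 2m, and work in the field of rational functions over ℚ in indeterminates a₁,…,a_n, x₁,…,x_n. Then det( (a_i − a_{m+j}) / (x_i² − x_{m+j}²) )_{1≤i,j≤m} = ( ∏_{1≤i<j≤n} (x_i + x_j) / ∏_{1≤i≤m<j≤n} (x_i² − x_j²) ) · Pf( (a_i − a_j)/(x_i + x_j) ), where Pf is the Pfaffian of the antisymmetric n × n matrix with (i,j) entry (a_i − a_j)/(x_i + x_j). -/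
open Finset

/-- The field of rational functions over `ℚ` in `aᵢ, xᵢ`, `1 ≤ i ≤ n`. -/
abbrev RatFunc11 (n : ℕ) : Type := FractionRing (MvPolynomial (Fin n ⊕ Fin n) ℚ)

noncomputable def A11 (n : ℕ) (i : Fin n) : RatFunc11 n :=
  algebraMap (MvPolynomial (Fin n ⊕ Fin n) ℚ) _ (MvPolynomial.X (Sum.inl i))

noncomputable def X11 (n : ℕ) (i : Fin n) : RatFunc11 n :=
  algebraMap (MvPolynomial (Fin n ⊕ Fin n) ℚ) _ (MvPolynomial.X (Sum.inr i))

theorem prod_prod_erase_sub {K : Type*} [CommRing K] {m : ℕ} (z : Fin m → K) :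
    ∏ j, ∏ k ∈ univ.erase j, (z j - z k) =
      (∏ i : Fin m, ∏ _j ∈ Ioi i, (-1 : K)) * (Matrix.vandermonde z).det ^ 2 := by
  have h (j : Fin m) : univ.erase j = (Iio j).disjUnion (Ioi j)
      (by rw [Finset.disjoint_left]; intro a; simp; order) := by
    ext k; simp
  have hL : ∏ j, ∏ k ∈ Iio j, (z j - z k) = (Matrix.vandermonde z).det := by
    rw [Matrix.det_vandermonde]
    exact prod_comm' (by simp)
  have hR : ∏ j, ∏ k ∈ Ioi j, (z j - z k) =
      (∏ i : Fin m, ∏ _j ∈ Ioi i, (-1 : K)) * (Matrix.vandermonde z).det := by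
    simp_rw [Matrix.det_vandermonde, ← prod_mul_distrib]
    exact prod_congr rfl fun i _ => prod_congr rfl fun j _ => by ring
  simp_rw [h, prod_disjUnion, prod_mul_distrib]
  rw [hL, hR]
  ring

theorem det_vandermonde_neg {K : Type*} [CommRing K] {m : ℕ} (z : Fin m → K) :
    (Matrix.vandermonde (-z)).det =
      (∏ i : Fin m, ∏ _j ∈ Ioi i, (-1 : K)) * (Matrix.vandermonde z).det := by
  simp_rw [Matrix.det_vandermonde, ← prod_mul_distrib]
  exact prod_congr rfl fun i _ => prod_congr rfl fun j _ => by simp; ring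

theorem prod_Ioi_neg_one_mul_self (K : Type*) [CommRing K] (m : ℕ) :
    (∏ i : Fin m, ∏ _j ∈ Ioi i, (-1 : K)) * (∏ i : Fin m, ∏ _j ∈ Ioi i, (-1 : K)) = 1 := by
  simp_rw [← prod_mul_distrib]
  simp

/-- The values at `y` of the Lagrange basis polynomials with nodes `z`. -/
noncomputable def lagrangeMatrix {K : Type*} [Field K] {m : ℕ} (y z : Fin m → K) :
    Matrix (Fin m) (Fin m) K :=
  Matrix.of fun i j => (Lagrange.basis univ z j).eval (y i)

theorem lagrangeMatrix_mul_vandermonde {K : Type*} [Field K] {m : ℕ} {y z : Fin m → K}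
    (hz : Function.Injective z) :
    lagrangeMatrix y z * Matrix.vandermonde z = Matrix.vandermonde y := by
  ext i k
  have h := Lagrange.eq_interpolate (s := univ) (v := z) (f := Polynomial.X ^ (k : ℕ)) hz.injOn
    (by simp)
  have h' := congrArg (Polynomial.eval (y i)) h
  simp only [Lagrange.interpolate_apply, Polynomial.eval_finsetSum, Polynomial.eval_mul,
    Polynomial.eval_C, Polynomial.eval_pow, Polynomial.eval_X] at h'
  simp only [Matrix.mul_apply, lagrangeMatrix, Matrix.of_apply, Matrix.vandermonde_apply]
  rw [h']
  exact sum_congr rfl fun _ _ => mul_comm _ _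

theorem lagrangeMatrix_apply {K : Type*} [Field K] {m : ℕ} {y z : Fin m → K}
    (hyz : ∀ i j, y i ≠ z j) (i j : Fin m) :
    lagrangeMatrix y z i j =
      (∏ k, (y i - z k)) * (∏ k ∈ univ.erase j, (z j - z k))⁻¹ * (y i - z j)⁻¹ := by
  rw [lagrangeMatrix, Matrix.of_apply, Lagrange.eval_basis_not_at_node (mem_univ j) (hyz i j),
    Lagrange.eval_nodal, Lagrange.nodalWeight, prod_inv_distrib, mul_assoc]

theorem det_mul_lagrangeMatrix {K : Type*} [Field K] {m : ℕ} {y z : Fin m → K}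
    (hz : Function.Injective z) (hyz : ∀ i j, y i ≠ z j) (c : Fin m → Fin m → K) :
    (Matrix.of fun i j => c i j * lagrangeMatrix y z i j).det *
        (Matrix.vandermonde z).det ^ 2 =
      (∏ i : Fin m, ∏ _j ∈ Ioi i, (-1 : K)) *
        ((∏ i, ∏ j, (y i - z j)) * (Matrix.of fun i j => c i j / (y i - z j)).det) := by
  have h : (Matrix.of fun i j => c i j * lagrangeMatrix y z i j).det =
      (∏ i, ∏ j, (y i - z j)) * ((∏ j, (∏ k ∈ univ.erase j, (z j - z k))⁻¹) *
        (Matrix.of fun i j => c i j / (y i - z j)).det) := by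
    rw [← Matrix.det_mul_row, ← Matrix.det_mul_column]
    congr 1
    ext i j
    simp only [Matrix.of_apply, lagrangeMatrix_apply hyz]
    ring
  have hv : (Matrix.vandermonde z).det ≠ 0 := Matrix.det_vandermonde_ne_zero_iff.2 hz
  have hs := prod_Ioi_neg_one_mul_self K m
  rw [h, prod_inv_distrib, prod_prod_erase_sub]
  set s := ∏ i : Fin m, ∏ _j ∈ Ioi i, (-1 : K)
  rw [mul_inv, inv_eq_of_mul_eq_one_left hs]
  field_simp

/-- The **Cauchy determinant**. -/
theorem det_cauchy {K : Type*} [Field K] {m : ℕ} {y z : Fin m → K}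
    (hz : Function.Injective z) (hyz : ∀ i j, y i + z j ≠ 0) :
    (∏ i, ∏ j, (y i + z j)) * (Matrix.of fun i j => 1 / (y i + z j)).det =
      (Matrix.vandermonde y).det * (Matrix.vandermonde z).det := by
  have hz' : Function.Injective (-z) := fun i j h => hz (neg_injective h)
  have h := det_mul_lagrangeMatrix (y := y) hz'
    (fun i j h => hyz i j (by simp [h])) (fun _ _ => 1)
  have hv : (Matrix.vandermonde z).det ≠ 0 := Matrix.det_vandermonde_ne_zero_iff.2 hz
  have hu := congrArg Matrix.det (lagrangeMatrix_mul_vandermonde (y := y) hz')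
  rw [Matrix.det_mul] at hu
  simp only [one_mul, Pi.neg_apply, sub_neg_eq_add] at h
  have he : (Matrix.of fun i j => lagrangeMatrix y (-z) i j) = lagrangeMatrix y (-z) := rfl
  have hs := prod_Ioi_neg_one_mul_self K m
  rw [he, sq, ← mul_assoc, hu, det_vandermonde_neg] at h
  linear_combination (-(∏ i : Fin m, ∏ _j ∈ Ioi i, (-1 : K))) * h +
    ((Matrix.vandermonde y).det * (Matrix.vandermonde z).det -
      (∏ i, ∏ j, (y i + z j)) * (Matrix.of fun i j => 1 / (y i + z j)).det) * hs

theorem det_fromBlocks_vandermonde {K : Type*} [Field K] {m : ℕ} {y z : Fin m → K}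
    (hz : Function.Injective z) (hyz : ∀ i j, y i ≠ z j) (a b : Fin m → K) :
    (Matrix.fromBlocks (Matrix.diagonal a * Matrix.vandermonde y) (Matrix.vandermonde y)
      (Matrix.diagonal b * Matrix.vandermonde z) (Matrix.vandermonde z)).det =
    (∏ i : Fin m, ∏ _j ∈ Ioi i, (-1 : K)) *
      ((∏ i, ∏ j, (y i - z j)) * (Matrix.of fun i j => (a i - b j) / (y i - z j)).det) := by
  have hv : (Matrix.vandermonde z).det ≠ 0 := Matrix.det_vandermonde_ne_zero_iff.2 hz
  have : Invertible (Matrix.vandermonde z) :=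
    Matrix.invertibleOfIsUnitDet _ (isUnit_iff_ne_zero.2 hv)
  rw [Matrix.det_fromBlocks₂₂, ← lagrangeMatrix_mul_vandermonde (y := y) hz,
    Matrix.mul_assoc (lagrangeMatrix y z), mul_invOf_self, Matrix.mul_one, ← Matrix.mul_assoc,
    ← Matrix.mul_assoc, ← Matrix.sub_mul, Matrix.det_mul, ← det_mul_lagrangeMatrix hz hyz]
  have : Matrix.diagonal a * lagrangeMatrix y z - lagrangeMatrix y z * Matrix.diagonal b =
      Matrix.of fun i j => (a i - b j) * lagrangeMatrix y z i j := by
    ext i j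
    simp only [Matrix.sub_apply, Matrix.diagonal_mul, Matrix.mul_diagonal, Matrix.of_apply]
    ring
  rw [this]
  ring

theorem sum_ite_sum_mul_inv {G H R : Type*} [Group G] [Fintype G] [Fintype H] [AddCommMonoid R]
    (c : G → Prop) [DecidablePred c] (ψ : H → G) (hc : ∀ σ, ∃! h, c (σ * ψ h)) (g : G → R) :
    ∑ σ, (if c σ then ∑ h, g (σ * (ψ h)⁻¹) else 0) = ∑ σ, g σ := by
  classical
  have h₁ (σ : G) : (if c σ then ∑ h, g (σ * (ψ h)⁻¹) else 0) =
      ∑ h, if c σ then g (σ * (ψ h)⁻¹) else 0 := by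
    split_ifs <;> simp
  have h₂ (h : H) : ∑ σ, (if c σ then g (σ * (ψ h)⁻¹) else 0) =
      ∑ σ, if c (σ * ψ h) then g σ else 0 := by
    rw [← Equiv.sum_comp (Equiv.mulRight (ψ h))]
    simp
  simp_rw [h₁]
  rw [sum_comm]
  simp_rw [h₂]
  rw [sum_comm]
  refine sum_congr rfl fun σ _ => ?_
  obtain ⟨h, hh, hu⟩ := hc σ
  rw [sum_eq_single h (fun b _ hb => if_neg fun hcb => hb (hu b hcb)) (by simp), if_pos hh]

/-- The element of the hyperoctahedral group permuting the pairs by `τ` and the entries of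
each pair by `ε`. -/
def pairPerm {m : ℕ} (h : (Fin m → Equiv.Perm Bool) × Equiv.Perm (Fin m)) :
    Equiv.Perm (Fin m × Bool) :=
  Equiv.prodCongrRight h.1 * Equiv.prodCongrLeft fun _ => h.2

theorem pairPerm_apply {m : ℕ} (ε : Fin m → Equiv.Perm Bool) (τ : Equiv.Perm (Fin m))
    (p : Fin m × Bool) : pairPerm (ε, τ) p = (τ p.1, ε (τ p.1) p.2) := rfl

theorem pairPerm_inv_apply {m : ℕ} (ε : Fin m → Equiv.Perm Bool) (τ : Equiv.Perm (Fin m))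
    (p : Fin m × Bool) : (pairPerm (ε, τ))⁻¹ p = (τ⁻¹ p.1, (ε p.1)⁻¹ p.2) := by
  rw [Equiv.Perm.inv_eq_iff_eq, pairPerm_apply]
  simp

theorem sign_pairPerm {m : ℕ} (ε : Fin m → Equiv.Perm Bool) (τ : Equiv.Perm (Fin m)) :
    (pairPerm (ε, τ)).sign = ∏ i, (ε i).sign := by
  simp [pairPerm, Equiv.Perm.sign_prodCongrRight, Equiv.Perm.sign_prodCongrLeft]

theorem univ_perm_bool : (univ : Finset (Equiv.Perm Bool)) = {1, Equiv.swap false true} := by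
  decide

theorem existsUnique_pairPerm {m : ℕ} {α : Type*} [LinearOrder α] {f : Fin m × Bool → α}
    (hf : Function.Injective f) :
    ∃! h, (∀ i, f (pairPerm h (i, false)) < f (pairPerm h (i, true))) ∧
      ∀ i j, i < j → f (pairPerm h (i, false)) < f (pairPerm h (j, false)) := by
  have hε (i : Fin m) : ∃! e : Equiv.Perm Bool, f (i, e false) < f (i, e true) := by
    have hne : f (i, false) ≠ f (i, true) := fun h => by simpa using hf h
    have hmem (e : Equiv.Perm Bool) : e = 1 ∨ e = Equiv.swap false true := by
      simpa [univ_perm_bool] using mem_univ e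
    rcases hne.lt_or_gt with h | h
    · refine ⟨1, by simpa, fun e he => (hmem e).resolve_right ?_⟩
      rintro rfl
      exact h.not_gt (by simpa using he)
    · refine ⟨Equiv.swap false true, by simpa, fun e he => (hmem e).resolve_left ?_⟩
      rintro rfl
      exact h.not_gt (by simpa using he)
  choose ε hε hεu using hε
  set q : Fin m → α := fun i => f (i, ε i false)
  have hq : Function.Injective q := fun i j h => congrArg Prod.fst (hf h)
  refine ⟨(ε, Tuple.sort q), ⟨fun i => hε (Tuple.sort q i), fun i j hij => ?_⟩, ?_⟩
  · exact ((Tuple.monotone_sort q).strictMono_of_injective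
      (hq.comp (Equiv.injective _))) hij
  · rintro ⟨ε', τ⟩ ⟨h₁, h₂⟩
    have : ε' = ε := funext fun i => hεu i _ (by simpa [pairPerm_apply] using h₁ (τ⁻¹ i))
    subst this
    have hm : StrictMono (q ∘ τ) := fun i j hij => h₂ i j hij
    have := Tuple.unique_monotone hm.monotone (Tuple.monotone_sort q)
    rw [show τ = Tuple.sort q from Equiv.ext fun i => hq (congrFun this i)]

/-- The pairing of `2 * i` with `2 * i + 1`. -/
def pairEquiv (m : ℕ) : Fin m × Bool ≃ Fin (2 * m) where
  toFun p := ⟨2 * p.1.val + p.2.toNat, by have := p.2.toNat_le; omega⟩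
  invFun k := (⟨k.val / 2, by omega⟩, decide (k.val % 2 = 1))
  left_inv := by
    rintro ⟨i, _ | _⟩
    · simp
    · ext
      · simp
        omega
      · simp
  right_inv k := by
    ext
    rcases Nat.mod_two_eq_zero_or_one k.val with h | h <;> simp [h] <;> omega

theorem factorial_mul_pfaffian {R : Type*} [CommRing R] (m : ℕ)
    (N : Fin (2 * m) → Fin (2 * m) → R) :
    (m.factorial : R) * pfaffian m (Matrix.of fun p q => N p q - N q p) =
      ∑ σ : Equiv.Perm (Fin (2 * m)), ((Equiv.Perm.sign σ : ℤ) : R) *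
        ∏ i : Fin m, N (σ (pairEquiv m (i, false))) (σ (pairEquiv m (i, true))) := by
  have hF (i : Fin m) : (⟨2 * i.val, by omega⟩ : Fin (2 * m)) = pairEquiv m (i, false) := rfl
  have hT (i : Fin m) : (⟨2 * i.val + 1, by omega⟩ : Fin (2 * m)) = pairEquiv m (i, true) := rfl
  rw [← sum_ite_sum_mul_inv (c := fun σ : Equiv.Perm (Fin (2 * m)) =>
      (∀ i : Fin m, σ ⟨2 * i.val, by omega⟩ < σ ⟨2 * i.val + 1, by omega⟩) ∧
       (∀ i j : Fin m, i < j → σ ⟨2 * i.val, by omega⟩ < σ ⟨2 * j.val, by omega⟩))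
    (fun h => (pairEquiv m).permCongr (pairPerm h))]
  · rw [pfaffian, mul_sum]
    refine sum_congr rfl fun σ _ => ?_
    rw [mul_ite, mul_zero]
    congr 1
    have key (τ : Equiv.Perm (Fin m)) :
        ∑ ε : Fin m → Equiv.Perm Bool,
          ((Equiv.Perm.sign (σ * ((pairEquiv m).permCongr (pairPerm (ε, τ)))⁻¹) : ℤ) : R) *
          ∏ i : Fin m, N ((σ * ((pairEquiv m).permCongr (pairPerm (ε, τ)))⁻¹)
            (pairEquiv m (i, false))) ((σ * ((pairEquiv m).permCongr (pairPerm (ε, τ)))⁻¹)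
            (pairEquiv m (i, true))) =
        ((Equiv.Perm.sign σ : ℤ) : R) * ∏ i : Fin m,
          (N (σ (pairEquiv m (i, false))) (σ (pairEquiv m (i, true))) -
            N (σ (pairEquiv m (i, true))) (σ (pairEquiv m (i, false)))) := by
      have hi (ε : Fin m → Equiv.Perm Bool) (p : Fin m × Bool) :
          ((pairEquiv m).permCongr (pairPerm (ε, τ)))⁻¹ (pairEquiv m p) =
            pairEquiv m (τ⁻¹ p.1, (ε p.1)⁻¹ p.2) := by
        rw [← pairPerm_inv_apply, Equiv.Perm.inv_eq_iff_eq]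
        simp
      simp only [Equiv.Perm.mul_apply, hi, Equiv.Perm.sign_mul, Equiv.Perm.sign_inv,
        Equiv.Perm.sign_permCongr, sign_pairPerm, Units.val_mul, Int.cast_mul, mul_assoc,
        Units.coe_prod, Int.cast_prod, ← mul_sum, ← prod_mul_distrib]
      rw [← Fintype.prod_sum (fun i (e : Equiv.Perm Bool) => ((e.sign : ℤ) : R) *
        N (σ (pairEquiv m (τ⁻¹ i, e⁻¹ false))) (σ (pairEquiv m (τ⁻¹ i, e⁻¹ true)))),
        ← Equiv.prod_comp τ]
      congr 1
      refine prod_congr rfl fun i _ => ?_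
      rw [univ_perm_bool, sum_pair (by decide)]
      simp [sub_eq_add_neg]
    rw [Fintype.sum_prod_type_right]
    simp only [key, sum_const, card_univ, Fintype.card_perm, Fintype.card_fin, nsmul_eq_mul]
    rfl
  · intro σ
    have := existsUnique_pairPerm (f := fun p => σ (pairEquiv m p))
      (σ.injective.comp (pairEquiv m).injective)
    simpa [hF, hT] using this

/-- The pairing of `2 * i` with `2 * i + 1`, with the two sides of the pairs as summands. -/
def interleaveEquiv (m : ℕ) : Fin m ⊕ Fin m ≃ Fin (2 * m) :=
  ((Equiv.boolProdEquivSum (Fin m)).symm.trans (Equiv.prodComm _ _)).trans (pairEquiv m)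

theorem interleaveEquiv_inl {m : ℕ} (i : Fin m) :
    interleaveEquiv m (Sum.inl i) = pairEquiv m (i, false) := rfl

theorem interleaveEquiv_inr {m : ℕ} (i : Fin m) :
    interleaveEquiv m (Sum.inr i) = pairEquiv m (i, true) := rfl

/-- The first half of `Fin (2 * m)` followed by the second half. -/
def blockEquiv (m : ℕ) : Fin m ⊕ Fin m ≃ Fin (2 * m) :=
  finSumFinEquiv.trans (finCongr (two_mul m).symm)

theorem val_blockEquiv_inl {m : ℕ} (i : Fin m) :
    (blockEquiv m (Sum.inl i)).val = i.val := rfl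

theorem val_blockEquiv_inr {m : ℕ} (i : Fin m) :
    (blockEquiv m (Sum.inr i)).val = m + i.val := rfl

theorem prod_prod_Ioi_eq_prod_prod_ite {R : Type*} [CommMonoid R] {n : ℕ}
    (f : Fin n → Fin n → R) :
    ∏ i, ∏ j ∈ Ioi i, f i j = ∏ i, ∏ j, if i < j then f i j else 1 := by
  refine prod_congr rfl fun i _ => ?_
  rw [← prod_filter]
  congr 1
  ext j
  simp

theorem sign_interleaveEquiv_symm_trans_blockEquiv (m : ℕ) :
    Equiv.Perm.sign ((interleaveEquiv m).symm.trans (blockEquiv m)) =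
      ∏ i : Fin m, ∏ _j ∈ Ioi i, (-1 : ℤˣ) := by
  rw [Equiv.Perm.sign_eq_prod_prod_Ioi, prod_prod_Ioi_eq_prod_prod_ite,
    prod_prod_Ioi_eq_prod_prod_ite, ← Equiv.prod_comp (interleaveEquiv m)]
  have h (p q : Fin m ⊕ Fin m) : (if interleaveEquiv m p < interleaveEquiv m q then
      (if blockEquiv m p < blockEquiv m q then (1 : ℤˣ) else -1) else 1) =
      match p, q with
      | Sum.inr i, Sum.inl j => if i < j then -1 else 1
      | _, _ => 1 := by
    rcases p with i | i <;> rcases q with j | j <;>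
      simp only [interleaveEquiv_inl, interleaveEquiv_inr, Fin.lt_def, val_blockEquiv_inl,
        val_blockEquiv_inr, pairEquiv, Equiv.coe_fn_mk, Bool.toNat_true, Bool.toNat_false] <;>
      split_ifs <;> first | rfl | omega
  calc _ = ∏ p, ∏ q, (if interleaveEquiv m p < interleaveEquiv m q then
      (if blockEquiv m p < blockEquiv m q then (1 : ℤˣ) else -1) else 1) := by
        refine prod_congr rfl fun p _ => ?_
        rw [← Equiv.prod_comp (interleaveEquiv m)]
        simp
    _ = _ := by simp [h]

theorem prod_ite_lt_add_eq_blocks {R : Type*} [CommRing R] {m : ℕ} (x : Fin (2 * m) → R) :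
    (∏ i, ∏ j, if i < j then x i + x j else 1) =
      (∏ i, ∏ j ∈ Ioi i, (x (blockEquiv m (Sum.inl i)) + x (blockEquiv m (Sum.inl j)))) *
      (∏ i, ∏ j ∈ Ioi i, (x (blockEquiv m (Sum.inr i)) + x (blockEquiv m (Sum.inr j)))) *
      ∏ i, ∏ j, (x (blockEquiv m (Sum.inl i)) + x (blockEquiv m (Sum.inr j))) := by
  rw [← Equiv.prod_comp (blockEquiv m), Fintype.prod_sum_type]
  have h (p : Fin (2 * m)) : (∏ j, if p < j then x p + x j else 1) = ∏ q,
      if p < blockEquiv m q then x p + x (blockEquiv m q) else 1 :=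
    (Equiv.prod_comp (blockEquiv m) _).symm
  simp_rw [h, Fintype.prod_sum_type, prod_mul_distrib, prod_prod_Ioi_eq_prod_prod_ite]
  have h₁ (i j : Fin m) : blockEquiv m (Sum.inl i) < blockEquiv m (Sum.inl j) ↔ i < j := by
    rw [Fin.lt_def, val_blockEquiv_inl, val_blockEquiv_inl, Fin.lt_def]
  have h₂ (i j : Fin m) : blockEquiv m (Sum.inr i) < blockEquiv m (Sum.inr j) ↔ i < j := by
    rw [Fin.lt_def, val_blockEquiv_inr, val_blockEquiv_inr, Fin.lt_def]; omega
  have h₃ (i j : Fin m) : blockEquiv m (Sum.inl i) < blockEquiv m (Sum.inr j) := by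
    rw [Fin.lt_def, val_blockEquiv_inl, val_blockEquiv_inr]; omega
  have h₄ (i j : Fin m) : ¬ blockEquiv m (Sum.inr i) < blockEquiv m (Sum.inl j) :=
    (h₃ j i).not_gt
  simp only [h₁, h₂, h₃, h₄, if_true, if_false, prod_const_one, one_mul]
  ring

theorem prod_Ioi_add_mul_det_vandermonde {R : Type*} [CommRing R] {n : ℕ} (x : Fin n → R) :
    (∏ i, ∏ j ∈ Ioi i, (x i + x j)) * (Matrix.vandermonde x).det =
      (Matrix.vandermonde fun i => x i ^ 2).det := by
  simp_rw [Matrix.det_vandermonde, ← prod_mul_distrib]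
  exact prod_congr rfl fun i _ => prod_congr rfl fun j _ => by ring

theorem det_vandermonde_comp_perm {R : Type*} [CommRing R] {n : ℕ} (x : Fin n → R)
    (σ : Equiv.Perm (Fin n)) :
    (Matrix.vandermonde (x ∘ σ)).det = σ.sign * (Matrix.vandermonde x).det :=
  Matrix.det_permute σ (Matrix.vandermonde x)

theorem prod_Ioi_add_comp_perm {K : Type*} [Field K] {n : ℕ} {x : Fin n → K}
    (hx : Function.Injective x) (σ : Equiv.Perm (Fin n)) :
    ∏ i, ∏ j ∈ Ioi i, (x (σ i) + x (σ j)) = ∏ i, ∏ j ∈ Ioi i, (x i + x j) := by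
  have h := prod_Ioi_add_mul_det_vandermonde (x ∘ σ)
  have hy := det_vandermonde_comp_perm (fun i => x i ^ 2) σ
  have hv : (Matrix.vandermonde (x ∘ σ)).det ≠ 0 :=
    Matrix.det_vandermonde_ne_zero_iff.2 (hx.comp σ.injective)
  refine mul_right_cancel₀ hv (h.trans (hy.trans ?_))
  rw [← prod_Ioi_add_mul_det_vandermonde, det_vandermonde_comp_perm]
  ring

theorem card_mul_sum_eq_sum_sum_mul {G H R : Type*} [Group G] [Fintype G] [Fintype H]
    [CommRing R] (ψ : H → G) (g : G → R) :
    (Fintype.card H : R) * ∑ ρ, g ρ = ∑ ρ, ∑ h, g (ρ * ψ h) := by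
  have hsum (h : H) : ∑ ρ, g (ρ * ψ h) = ∑ ρ, g ρ := Equiv.sum_comp (Equiv.mulRight (ψ h)) g
  rw [sum_comm]
  simp [hsum]

theorem factorial_mul_sum_prod {R : Type*} [CommRing R] {m : ℕ}
    (a : Fin m ⊕ Fin m → R) (f : Fin m ⊕ Fin m → Fin m ⊕ Fin m → R) :
    (m.factorial : R) * ∑ ρ : Equiv.Perm (Fin m ⊕ Fin m), ((ρ.sign : ℤ) : R) *
        ∏ i, a (ρ (Sum.inl i)) * f (ρ (Sum.inl i)) (ρ (Sum.inr i)) =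
      ∑ ρ : Equiv.Perm (Fin m ⊕ Fin m), ((ρ.sign : ℤ) : R) * ((∏ i, a (ρ (Sum.inl i))) *
        (Matrix.of fun i j => f (ρ (Sum.inl i)) (ρ (Sum.inr j))).det) := by
  have h := card_mul_sum_eq_sum_sum_mul
    (fun τ : Equiv.Perm (Fin m) => Equiv.Perm.sumCongr 1 τ)
    (fun ρ : Equiv.Perm (Fin m ⊕ Fin m) => ((ρ.sign : ℤ) : R) *
        ∏ i, a (ρ (Sum.inl i)) * f (ρ (Sum.inl i)) (ρ (Sum.inr i)))
  rw [Fintype.card_perm, Fintype.card_fin] at h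
  rw [h]
  refine sum_congr rfl fun ρ _ => ?_
  rw [← Matrix.det_transpose, Matrix.det_apply', mul_sum, mul_sum]
  refine sum_congr rfl fun τ _ => ?_
  simp only [Equiv.Perm.sign_mul, Equiv.Perm.sign_sumCongr, Equiv.Perm.mul_apply,
    Equiv.Perm.sumCongr_apply, Sum.map_inl, Sum.map_inr, Equiv.Perm.one_apply,
    Equiv.Perm.sign_one, one_mul, Units.val_mul, Int.cast_mul, prod_mul_distrib,
    Matrix.transpose_apply, Matrix.of_apply]
  ring

/-- The generalized Vandermonde matrix with rows `(aₚ, aₚ yₚ, …, aₚ yₚ ^ (m - 1), 1, yₚ, …)`. -/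
def doubleVandermonde {R : Type*} [CommRing R] {m : ℕ} (a y : Fin m ⊕ Fin m → R) :
    Matrix (Fin m ⊕ Fin m) (Fin m ⊕ Fin m) R :=
  Matrix.of fun p => Sum.elim (fun k => a p * y p ^ (k : ℕ)) (fun k => y p ^ (k : ℕ))

theorem doubleVandermonde_eq_fromBlocks {R : Type*} [CommRing R] {m : ℕ}
    (a y : Fin m ⊕ Fin m → R) :
    doubleVandermonde a y = Matrix.fromBlocks
      (Matrix.diagonal (a ∘ Sum.inl) * Matrix.vandermonde (y ∘ Sum.inl))
      (Matrix.vandermonde (y ∘ Sum.inl))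
      (Matrix.diagonal (a ∘ Sum.inr) * Matrix.vandermonde (y ∘ Sum.inr))
      (Matrix.vandermonde (y ∘ Sum.inr)) := by
  ext (i | i) (j | j) <;> simp [doubleVandermonde, Matrix.vandermonde_apply]

theorem factorial_sq_mul_det_doubleVandermonde {R : Type*} [CommRing R] {m : ℕ}
    (a y : Fin m ⊕ Fin m → R) :
    (m.factorial * m.factorial : R) * (doubleVandermonde a y).det =
      ∑ ρ : Equiv.Perm (Fin m ⊕ Fin m), ((ρ.sign : ℤ) : R) * ((∏ i, a (ρ (Sum.inl i))) *
        ((Matrix.vandermonde fun i => y (ρ (Sum.inl i))).det *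
          (Matrix.vandermonde fun i => y (ρ (Sum.inr i))).det)) := by
  have h := card_mul_sum_eq_sum_sum_mul
    (fun τ : Equiv.Perm (Fin m) × Equiv.Perm (Fin m) => Equiv.Perm.sumCongr τ.1 τ.2)
    (fun ρ : Equiv.Perm (Fin m ⊕ Fin m) => ((ρ.sign : ℤ) : R) *
        ∏ p, doubleVandermonde a y (ρ p) p)
  rw [Fintype.card_prod, Fintype.card_perm, Fintype.card_fin, Nat.cast_mul,
    ← Matrix.det_apply'] at h
  rw [h]
  refine sum_congr rfl fun ρ _ => ?_
  rw [Matrix.det_apply', Matrix.det_apply', sum_mul_sum, ← sum_product', mul_sum, mul_sum]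
  refine sum_congr rfl fun τ _ => ?_
  simp only [Equiv.Perm.sign_mul, Equiv.Perm.sign_sumCongr, Equiv.Perm.mul_apply,
    Equiv.Perm.sumCongr_apply, Sum.map_inl, Sum.map_inr, Fintype.prod_sum_type,
    Units.val_mul, Int.cast_mul, prod_mul_distrib, doubleVandermonde, Sum.elim_inl, Sum.elim_inr,
    Matrix.of_apply, Matrix.vandermonde_apply]
  rw [Equiv.prod_comp τ.1 fun i => a (ρ (Sum.inl i))]
  ring

theorem prod_mul_sum_eq_det_doubleVandermonde {K : Type*} [Field K] [CharZero K] {m : ℕ}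
    (a x : Fin (2 * m) → K) (hx : Function.Injective x) (hxx : ∀ p q, p ≠ q → x p + x q ≠ 0) :
    (∏ i, ∏ j, if i < j then x i + x j else 1) *
      ∑ ρ : Equiv.Perm (Fin m ⊕ Fin m), ((ρ.sign : ℤ) : K) *
        ∏ i, a (blockEquiv m (ρ (Sum.inl i))) *
          (1 / (x (blockEquiv m (ρ (Sum.inl i))) + x (blockEquiv m (ρ (Sum.inr i))))) =
      m.factorial *
        (doubleVandermonde (a ∘ blockEquiv m) fun p => x (blockEquiv m p) ^ 2).det := by
  have hm : (m.factorial : K) ≠ 0 := Nat.cast_ne_zero.2 m.factorial_ne_zero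
  refine mul_left_cancel₀ hm ?_
  rw [mul_left_comm, factorial_mul_sum_prod (fun p => a (blockEquiv m p))
    (fun p q => 1 / (x (blockEquiv m p) + x (blockEquiv m q))), ← mul_assoc (m.factorial : K),
    factorial_sq_mul_det_doubleVandermonde, mul_sum]
  refine sum_congr rfl fun ρ _ => ?_
  have hD := prod_Ioi_add_comp_perm hx ((blockEquiv m).permCongr ρ)
  rw [prod_prod_Ioi_eq_prod_prod_ite, prod_prod_Ioi_eq_prod_prod_ite,
    prod_ite_lt_add_eq_blocks fun i => x ((blockEquiv m).permCongr ρ i)] at hD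
  simp only [Equiv.permCongr_apply, Equiv.symm_apply_apply] at hD
  have hinj (s : Fin m → Fin m ⊕ Fin m) (hs : Function.Injective s) :
      Function.Injective fun i => x (blockEquiv m (ρ (s i))) :=
    hx.comp ((blockEquiv m).injective.comp (ρ.injective.comp hs))
  have hC := det_cauchy (y := fun i => x (blockEquiv m (ρ (Sum.inl i))))
    (hinj _ Sum.inr_injective) (fun i j => hxx _ _ (by simp))
  have hl := prod_Ioi_add_mul_det_vandermonde fun i => x (blockEquiv m (ρ (Sum.inl i)))
  have hr := prod_Ioi_add_mul_det_vandermonde fun i => x (blockEquiv m (ρ (Sum.inr i)))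
  rw [← hD, ← hl, ← hr, mul_mul_mul_comm (∏ i, ∏ j ∈ Ioi i, _) (Matrix.det _),
    ← hC]
  simp only [Function.comp_apply]
  ring

theorem factorial_mul_pfaffian_eq_sign_mul_sum {R : Type*} [CommRing R] (m : ℕ)
    (N : Fin (2 * m) → Fin (2 * m) → R) :
    (m.factorial : R) * pfaffian m (Matrix.of fun p q => N p q - N q p) =
      (∏ i : Fin m, ∏ _j ∈ Ioi i, (-1 : R)) *
      ∑ ρ : Equiv.Perm (Fin m ⊕ Fin m), ((ρ.sign : ℤ) : R) *
        ∏ i, N (blockEquiv m (ρ (Sum.inl i))) (blockEquiv m (ρ (Sum.inr i))) := by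
  rw [factorial_mul_pfaffian, mul_sum,
    ← Equiv.sum_comp (Equiv.equivCongr (interleaveEquiv m) (blockEquiv m))]
  refine sum_congr rfl fun (ρ : Equiv.Perm (Fin m ⊕ Fin m)) _ => ?_
  have hs : Equiv.Perm.sign (Equiv.equivCongr (interleaveEquiv m) (blockEquiv m) ρ) =
      (∏ i : Fin m, ∏ _j ∈ Ioi i, (-1 : ℤˣ)) * ρ.sign := by
    have : Equiv.equivCongr (interleaveEquiv m) (blockEquiv m) ρ =
        ((interleaveEquiv m).symm.trans (blockEquiv m)).trans
          (((blockEquiv m).symm.trans ρ).trans (blockEquiv m)) := by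
      ext; simp
    rw [this, Equiv.Perm.sign_trans, Equiv.Perm.sign_symm_trans_trans, mul_comm,
      sign_interleaveEquiv_symm_trans_blockEquiv]
  rw [hs]
  simp [← interleaveEquiv_inl, ← interleaveEquiv_inr, mul_assoc]

theorem det_eq_pfaffian_ratio_of_injective {K : Type*} [Field K] [CharZero K] {m : ℕ}
    (a x : Fin (2 * m) → K) (hx : Function.Injective x) (hxx : ∀ p q, p ≠ q → x p + x q ≠ 0) :
    Matrix.det (Matrix.of fun i j : Fin m =>
        (a (blockEquiv m (Sum.inl i)) - a (blockEquiv m (Sum.inr j))) /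
          (x (blockEquiv m (Sum.inl i)) ^ 2 - x (blockEquiv m (Sum.inr j)) ^ 2)) =
      ((∏ i : Fin (2 * m), ∏ j : Fin (2 * m), if i < j then x i + x j else 1) /
          (∏ i : Fin m, ∏ j : Fin m,
            (x (blockEquiv m (Sum.inl i)) ^ 2 - x (blockEquiv m (Sum.inr j)) ^ 2))) *
        pfaffian m (Matrix.of fun i j : Fin (2 * m) => (a i - a j) / (x i + x j)) := by
  have hm : (m.factorial : K) ≠ 0 := Nat.cast_ne_zero.2 m.factorial_ne_zero
  have hsq (p q) (h : p ≠ q) : x p ^ 2 ≠ x q ^ 2 := by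
    rw [Ne, sq_eq_sq_iff_eq_or_eq_neg, not_or]
    exact ⟨hx.ne h, fun h' => hxx p q h (by rw [h', neg_add_cancel])⟩
  have hy : Function.Injective fun j => x (blockEquiv m (Sum.inr j)) ^ 2 := fun i j h => by
    by_contra hne
    exact hsq _ _ (by simpa using hne) h
  have hyz (i j : Fin m) :
      x (blockEquiv m (Sum.inl i)) ^ 2 ≠ x (blockEquiv m (Sum.inr j)) ^ 2 :=
    hsq _ _ (by simp)
  have hW := det_fromBlocks_vandermonde hy hyz (fun i => a (blockEquiv m (Sum.inl i)))
    (fun i => a (blockEquiv m (Sum.inr i)))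
  have hV := prod_mul_sum_eq_det_doubleVandermonde a x hx hxx
  rw [doubleVandermonde_eq_fromBlocks] at hV
  have hP := factorial_mul_pfaffian_eq_sign_mul_sum m fun p q => a p * (1 / (x p + x q))
  have hM : (Matrix.of fun p q => a p * (1 / (x p + x q)) - a q * (1 / (x q + x p))) =
      Matrix.of fun i j : Fin (2 * m) => (a i - a j) / (x i + x j) := by
    ext p q
    rw [Matrix.of_apply, Matrix.of_apply, add_comm (x q)]
    ring
  rw [hM] at hP
  have hs := prod_Ioi_neg_one_mul_self K m
  have hprod : ∏ i, ∏ j, (x (blockEquiv m (Sum.inl i)) ^ 2 -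
      x (blockEquiv m (Sum.inr j)) ^ 2) ≠ 0 :=
    prod_ne_zero_iff.2 fun i _ => prod_ne_zero_iff.2 fun j _ => sub_ne_zero.2 (hyz i j)
  rw [div_mul_eq_mul_div, eq_div_iff hprod]
  refine mul_left_cancel₀ hm ?_
  rw [mul_left_comm _ _ (pfaffian _ _), hP,
    mul_left_comm _ (∏ i : Fin m, ∏ _j ∈ Ioi i, (-1 : K)), hV]
  simp only [Function.comp_def]
  rw [hW, mul_left_comm (m.factorial : K) (∏ i : Fin m, ∏ _j ∈ Ioi i, (-1 : K)),
    ← mul_assoc (∏ i : Fin m, ∏ _j ∈ Ioi i, (-1 : K)), hs]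
  ring

/-- `det((aᵢ-a_{m+j})/(xᵢ²-x_{m+j}²))_{1≤i,j≤m}
  = (∏_{1≤i<j≤n}(xᵢ+xⱼ) / ∏_{1≤i≤m<j≤n}(xᵢ²-xⱼ²)) · Pf((aᵢ-aⱼ)/(xᵢ+xⱼ))`. -/
theorem det_eq_pfaffian_ratio (m : ℕ) (hm : 1 ≤ m) :
    Matrix.det (Matrix.of fun i j : Fin m =>
        (A11 (2 * m) ⟨i.val, by omega⟩ - A11 (2 * m) ⟨m + j.val, by omega⟩) /
          (X11 (2 * m) ⟨i.val, by omega⟩ ^ 2 - X11 (2 * m) ⟨m + j.val, by omega⟩ ^ 2))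
      = ((∏ i : Fin (2 * m), ∏ j : Fin (2 * m),
            if i < j then X11 (2 * m) i + X11 (2 * m) j else 1) /
          (∏ i : Fin m, ∏ j : Fin m,
            (X11 (2 * m) ⟨i.val, by omega⟩ ^ 2 - X11 (2 * m) ⟨m + j.val, by omega⟩ ^ 2))) *
        pfaffian m (Matrix.of fun i j : Fin (2 * m) =>
          (A11 (2 * m) i - A11 (2 * m) j) / (X11 (2 * m) i + X11 (2 * m) j)) := by
  have hinj := IsFractionRing.injective (MvPolynomial (Fin (2 * m) ⊕ Fin (2 * m)) ℚ)
    (RatFunc11 (2 * m))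
  have : CharZero (RatFunc11 (2 * m)) := charZero_of_injective_algebraMap hinj
  refine det_eq_pfaffian_ratio_of_injective (A11 (2 * m)) (X11 (2 * m))
    (fun p q h => Sum.inr_injective (MvPolynomial.X_injective (hinj h))) fun p q hpq h => ?_
  rw [X11, X11, ← map_add, map_eq_zero_iff _ hinj] at h
  have h' := congrArg (MvPolynomial.eval (Pi.single (Sum.inr p) 1)) h
  simp [hpq.symm] at h'
end

section
/- Let λ be a partition of n (in French convention: rows numbered 0, 1, 2, … from the bottom, row lengths weakly decreasing upwards). For a standard Young tableau t of shape λ (a bijective filling by 1,…,n increasing along rows left-to-right and up columns), define the Specht polynomial Δ_t(x₁,…,x_n) := ∏ over columns C of t, ∏ over pairs of entries a, b in C with a in a lower row than b, of (x_a − x_b). Let ℵ be the bottom tableau, whose rows, read from the bottom row upward, are filled with consecutive integers 1, 2, …, n. Let e be the evaluation sending x_i to the (rational number equal to the) index of the row of ℵ containing i. Suppose f(x₁,…,x_n) = ∑_t c_t Δ_t(x₁,…,x_n) is a linear combination over ℚ of the Specht polynomials of all standard tableaux of shape λ. Then Δ_ℵ evaluated at e is nonzero, Δ_t evaluated at e is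 zero for every standard tableau t ≠ ℵ of shape λ, and consequently c_ℵ = f(e) / Δ_ℵ(e). -/
open Finset

/-- A standard Young tableau of shape `lam` (French convention: rows indexed from `0` at
the bottom, row lengths `lam 0 ≥ lam 1 ≥ ⋯` weakly decreasing), filled bijectively with
the entries `1,…,n` (entry `i+1` encoded as `i : Fin n`): `row i` and `col i` give the
row and column of entry `i+1`; entries increase along rows (left to right) and up
columns. -/
structure SpechtTableau (n : ℕ) (lam : ℕ → ℕ) where
  row : Fin n → ℕ
  col : Fin n → ℕ
  mem : ∀ i, col i < lam (row i)
  inj : Function.Injective fun i => (row i, col i)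
  surj : ∀ r c : ℕ, c < lam r → ∃ i, row i = r ∧ col i = c
  rowInc : ∀ i j, row i = row j → col i < col j → i < j
  colInc : ∀ i j, col i = col j → row i < row j → i < j

/-- The Specht polynomial of a tableau, as a function of the variables `x₁,…,x_n`:
the product, over all pairs of entries `a, b` lying in the same column with `a` in a
lower row than `b`, of `(x_a - x_b)`. -/
def specht {n : ℕ} {lam : ℕ → ℕ} (t : SpechtTableau n lam) (x : Fin n → ℚ) : ℚ :=
  ∏ i : Fin n, ∏ j : Fin n,
    if t.col i = t.col j ∧ t.row i < t.row j then x i - x j else 1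

namespace SpechtTableau

variable {n : ℕ} {lam : ℕ → ℕ}

/-- Within a row, columns are ordered as the entries are. -/
theorem col_lt_col (t : SpechtTableau n lam) {i j : Fin n} (hr : t.row i = t.row j)
    (hij : i < j) : t.col i < t.col j := by
  rcases lt_trichotomy (t.col i) (t.col j) with h | h | h
  · exact h
  · exact absurd (t.inj (Prod.ext hr h)) hij.ne
  · exact absurd (t.rowInc j i hr.symm h) hij.asymm

/-- The column of an entry is the number of smaller entries in its row. -/
theorem col_eq_card (t : SpechtTableau n lam) (i : Fin n) :
    t.col i = #{j | t.row j = t.row i ∧ j < i} := by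
  have himage : ({j | t.row j = t.row i ∧ j < i} : Finset (Fin n)).image t.col =
      range (t.col i) := by
    ext c
    simp only [mem_image, mem_filter, mem_univ, true_and, mem_range]
    constructor
    · rintro ⟨j, ⟨hr, hj⟩, rfl⟩
      exact t.col_lt_col hr hj
    · intro hc
      obtain ⟨j, hr, rfl⟩ := t.surj (t.row i) c (hc.trans (t.mem i))
      exact ⟨j, ⟨hr, t.rowInc j i hr hc⟩, rfl⟩
  rw [← card_range (t.col i), ← himage, card_image_of_injOn]
  intro j hj k hk hjk
  simp only [coe_filter, mem_univ, true_and, Set.mem_ofPred_eq] at hj hk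
  exact t.inj (Prod.ext (hj.1.trans hk.1.symm) hjk)

/-- A standard tableau is determined by its row function. -/
theorem row_injective : Function.Injective (row : SpechtTableau n lam → Fin n → ℕ) := by
  intro s t h
  have hcol : s.col = t.col := by
    funext i
    rw [s.col_eq_card, t.col_eq_card, h]
  cases s
  cases t
  simp_all

/-- The sum of the row indices depends only on the shape. -/
theorem sum_row_eq (s t : SpechtTableau n lam) : ∑ i, s.row i = ∑ i, t.row i := by
  choose σ hrow hcol using fun i => t.surj (s.row i) (s.col i) (s.mem i)
  have hσ : Function.Injective σ := fun i j h =>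
    s.inj (Prod.ext (by simp only [← hrow, h]) (by simp only [← hcol, h]))
  rw [← (Finite.injective_iff_bijective.mp hσ).sum_comp t.row]
  exact sum_congr rfl fun i _ => (hrow i).symm

/-- A monotone function that separates the entries of each column dominates the row function. -/
theorem row_le_of_monotone (hlam : Antitone lam) (t : SpechtTableau n lam) {g : Fin n → ℕ}
    (hg : Monotone g) (hne : ∀ i j, t.col i = t.col j → t.row i < t.row j → g i ≠ g j)
    (i : Fin n) : t.row i ≤ g i := by
  induction h : t.row i generalizing i with
  | zero => exact Nat.zero_le _
  | succ r ih =>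
    obtain ⟨j, hr, hc⟩ := t.surj r (t.col i) ((t.mem i).trans_le (hlam (by omega)))
    have hlt : t.row j < t.row i := by omega
    have hgj := (hg (t.colInc j i hc hlt).le).lt_of_ne (hne j i hc hlt)
    exact (ih j hr).trans_lt hgj

end SpechtTableau

theorem specht_ne_zero_iff {n : ℕ} {lam : ℕ → ℕ} (t : SpechtTableau n lam) (x : Fin n → ℚ) :
    specht t x ≠ 0 ↔ ∀ i j, t.col i = t.col j → t.row i < t.row j → x i ≠ x j := by
  simp only [specht, prod_ne_zero_iff, mem_univ, true_imp_iff]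
  refine forall₂_congr fun i j => ?_
  split_ifs with h
  · simp [h.1, h.2, sub_eq_zero]
  · simp only [ne_eq, one_ne_zero, not_false_eq_true, true_iff]
    exact fun hc hr => absurd ⟨hc, hr⟩ h

/-- Let `ℵ` be the bottom tableau (rows filled with consecutive integers from the bottom
row upward, i.e. its row function is monotone in the entries), and let `e` be the
evaluation sending `x_i` to the row index of `i` in `ℵ`. If `f = ∑_t c_t Δ_t` is a
linear combination of the Specht polynomials of all standard tableaux of shape `λ`,
then `Δ_ℵ(e) ≠ 0`, `Δ_t(e) = 0` for every standard tableau `t ≠ ℵ`, and consequently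
`c_ℵ = f(e) / Δ_ℵ(e)`. -/
theorem specht_bottom_coefficient (n : ℕ) (lam : ℕ → ℕ) (hn : 1 ≤ n)
    (hlam : Antitone lam) (hsum : ∑ r ∈ Finset.range n, lam r = n)
    (hzero : ∀ r, n ≤ r → lam r = 0)
    (aleph : SpechtTableau n lam) (haleph : Monotone aleph.row)
    (c : SpechtTableau n lam → ℚ)
    (f : (Fin n → ℚ) → ℚ)
    (hf : f = fun x => ∑ᶠ t : SpechtTableau n lam, c t * specht t x)
    (e : Fin n → ℚ) (he : e = fun i => (aleph.row i : ℚ)) :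
    specht aleph e ≠ 0 ∧
    (∀ t : SpechtTableau n lam, t ≠ aleph → specht t e = 0) ∧
    c aleph = f e / specht aleph e := by
  subst hf he
  have hbot : specht aleph (fun i => (aleph.row i : ℚ)) ≠ 0 :=
    (specht_ne_zero_iff _ _).mpr fun i j _ hr => Nat.cast_injective.ne hr.ne
  have hother : ∀ t : SpechtTableau n lam, t ≠ aleph →
      specht t (fun i => (aleph.row i : ℚ)) = 0 := by
    intro t
    contrapose!
    intro ht
    have hle := t.row_le_of_monotone hlam haleph fun i j hc hr h =>
      (specht_ne_zero_iff _ _).mp ht i j hc hr (congrArg Nat.cast h)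
    have heq := (sum_eq_sum_iff_of_le fun i _ => hle i).mp (t.sum_row_eq aleph)
    exact SpechtTableau.row_injective (funext fun i => heq i (mem_univ i))
  refine ⟨hbot, hother, ?_⟩
  rw [eq_div_iff hbot]
  symm
  apply finsum_eq_single
  intro t ht
  rw [hother t ht, mul_zero]
end
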